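/- For every δ ∈ (0, 1) there exists a constant C_δ > 0 such that for every real ε with |ε| > δ and |ε − 1| > δ, and every Schwartz function f : ℝ → ℂ, one has ‖C_ε^{odd} f‖_{L²(ℝ)} ≤ C_δ ‖f‖_{L²(ℝ)}. -/

import Mathlib

open MeasureTheory Filter Set
open scoped ENNReal Topology

/-- Principal value integral: the limit, as `δ → 0⁺` and `R → ∞`, of
`∫_{δ ≤ |y| ≤ R} g(y) dy`. -/
noncomputable def pvIntegral (g : ℝ → ℂ) : ℂ :=
  limUnder ((nhdsWithin (0 : ℝ) (Set.Ioi 0)) ×ˢ Filter.atTop)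
    (fun p : ℝ × ℝ => ∫ y in {y : ℝ | p.1 ≤ |y| ∧ |y| ≤ p.2}, g y)

/-- The odd fractional Carleson operator
`C_ε^{odd} f(x) = sup_{A ∈ ℝ} | p.v. ∫ e^{i A sgn(y) |y|^ε} f(x-y) dy/y |`. -/
noncomputable def carlesonOdd (ε : ℝ) (f : ℝ → ℂ) (x : ℝ) : ℝ≥0∞ :=
  ⨆ A : ℝ, (‖pvIntegral (fun y =>
    Complex.exp (Complex.I * (A : ℂ) * ((Real.sign y * |y| ^ ε : ℝ) : ℂ)) * f (x - y) / (y : ℂ))‖₊ : ℝ≥0∞)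


namespace OC

lemma cs {α : Type*} [MeasurableSpace α] {μ : Measure α} {f g : α → ℝ≥0∞}
    (hf : AEMeasurable f μ) (hg : AEMeasurable g μ) :
    (∫⁻ x, f x * g x ∂μ) ^ 2 ≤ (∫⁻ x, f x ^ 2 ∂μ) * (∫⁻ x, g x ^ 2 ∂μ) := by
  have h := ENNReal.lintegral_mul_le_Lp_mul_Lq μ Real.HolderConjugate.two_two hf hg
  simp only [Pi.mul_apply, ENNReal.rpow_two] at h
  calc (∫⁻ x, f x * g x ∂μ) ^ 2 ≤ ((∫⁻ x, f x ^ 2 ∂μ) ^ (1 / (2:ℝ)) * (∫⁻ x, g x ^ 2 ∂μ) ^ (1 / (2:ℝ))) ^ 2 := by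
        gcongr
    _ = _ := by
        rw [mul_pow, ← ENNReal.rpow_two, ← ENNReal.rpow_two, ← ENNReal.rpow_mul, ← ENNReal.rpow_mul]
        norm_num

lemma meas_sel {β : Type*} [MeasurableSpace β] {u : ℕ → ℝ → β} (hu : ∀ i, Measurable (u i)) {s : ℝ → ℕ}
    (hs : Measurable s) : Measurable (fun x => u (s x) x) := by
  have h : Measurable (fun p : ℕ × ℝ => u p.1 p.2) :=
    measurable_from_prod_countable_right (fun n => hu n)
  exact h.comp (hs.prodMk measurable_id)

lemma exists_sel {u : ℕ → ℝ → ℝ≥0∞} (hu : ∀ i, Measurable (u i)) (n : ℕ) :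
    ∃ s : ℝ → ℕ, Measurable s ∧ (∀ x, s x ≤ n) ∧ ∀ x, ∀ i ≤ n, u i x ≤ u (s x) x := by
  induction n with
  | zero =>
    refine ⟨fun _ => 0, measurable_const, fun _ => le_rfl, fun x i hi => ?_⟩
    obtain rfl : i = 0 := by omega
    exact le_rfl
  | succ n ih =>
    obtain ⟨s, hs, hsn, hsm⟩ := ih
    refine ⟨fun x => if u (s x) x < u (n + 1) x then n + 1 else s x, ?_, ?_, ?_⟩
    · exact Measurable.ite (measurableSet_lt (meas_sel hu hs) (hu _)) measurable_const hs
    · intro x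
      have := hsn x
      dsimp only
      split_ifs <;> omega
    · intro x i hi
      dsimp only
      rcases Nat.lt_or_ge n i with h | h
      · obtain rfl : i = n + 1 := by omega
        split_ifs with h1
        · exact le_rfl
        · exact not_lt.1 h1
      · split_ifs with h1
        · exact (hsm x i h).trans h1.le
        · exact hsm x i h

lemma sup_bound {u : ℕ → ℝ → ℝ≥0∞} (hu : ∀ i, Measurable (u i)) {B : ℝ≥0∞}
    (h : ∀ n, ∀ s : ℝ → ℕ, Measurable s → (∀ x, s x ≤ n) → ∫⁻ x, (u (s x) x) ^ 2 ≤ B) :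
    ∫⁻ x, (⨆ i, u i x) ^ 2 ≤ B := by
  have h1 : ∀ x, (⨆ i, u i x) ^ 2 = ⨆ n : ℕ, (⨆ i : ℕ, ⨆ _ : i ≤ n, u i x) ^ 2 := by
    intro x
    rw [← ENNReal.iSup_pow]
    congr 1
    apply le_antisymm
    · exact iSup_le fun i => le_iSup_of_le i (le_iSup₂_of_le i le_rfl le_rfl)
    · exact iSup_le fun n => iSup₂_le fun i _ => le_iSup (fun i => u i x) i
  simp_rw [h1]
  rw [lintegral_iSup]
  · refine iSup_le fun n => ?_
    obtain ⟨s, hs, hsn, hsm⟩ := exists_sel hu n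
    refine le_trans (lintegral_mono fun x => ?_) (h n s hs hsn)
    dsimp only
    gcongr
    exact iSup₂_le fun i hi => hsm x i hi
  · intro n
    refine Measurable.pow_const ?_ 2
    exact Measurable.iSup fun i => Measurable.iSup fun _ => hu i
  · intro m n hmn x
    dsimp only
    refine pow_le_pow_left' ?_ 2
    exact iSup₂_le fun i hi => le_iSup₂_of_le i (le_trans hi hmn) le_rfl

/-- Poisson type kernel -/
noncomputable def pk (r z : ℝ) : ℝ≥0∞ := ENNReal.ofReal (r / (r ^ 2 + z ^ 2))

lemma pk_meas2 : Measurable (fun p : ℝ × ℝ => pk p.1 p.2) := by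
  unfold pk; fun_prop

lemma pk_meas (r : ℝ) : Measurable (pk r) := by
  unfold pk; fun_prop

lemma pk_symm (r z : ℝ) : pk r (-z) = pk r z := by simp [pk]

lemma pk_comm (r x y : ℝ) : pk r (x - y) = pk r (y - x) := by
  rw [← pk_symm, neg_sub]

lemma integrable_pois {r : ℝ} (hr : 0 < r) : Integrable (fun z : ℝ => r / (r ^ 2 + z ^ 2)) := by
  have h := (integrable_inv_one_add_sq.comp_div hr.ne').const_mul (1/r)
  refine h.congr (Eventually.of_forall fun z => ?_)
  dsimp only
  field_simp

lemma integral_pois {r : ℝ} (hr : 0 < r) : ∫ z : ℝ, r / (r ^ 2 + z ^ 2) = Real.pi := by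
  have h : ∀ z : ℝ, r / (r ^ 2 + z ^ 2) = (1/r) * (fun z : ℝ => (1 + z ^ 2)⁻¹) (z / r) := by
    intro z; dsimp only; field_simp
  simp_rw [h]
  rw [integral_const_mul, Measure.integral_comp_div (fun z : ℝ => (1 + z ^ 2)⁻¹) r, integral_univ_inv_one_add_sq, abs_of_pos hr,
    smul_eq_mul]
  field_simp

lemma pk_lint {r : ℝ} (hr : 0 < r) : ∫⁻ z, pk r z = ENNReal.ofReal Real.pi := by
  unfold pk
  rw [← ofReal_integral_eq_lintegral_ofReal (integrable_pois hr)
    (Eventually.of_forall fun z => by positivity), integral_pois hr]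

lemma pk_lint' {r : ℝ} (hr : 0 < r) (x : ℝ) : ∫⁻ y, pk r (x - y) = ENNReal.ofReal Real.pi := by
  rw [lintegral_sub_left_eq_self (pk r) x, pk_lint hr]

lemma pk_far {r w z : ℝ} (hr : 0 < r) (h : |z| / 2 ≤ |w|) : pk r w ≤ 4 * pk r z := by
  unfold pk
  rw [show (4 : ℝ≥0∞) = ENNReal.ofReal 4 by simp, ← ENNReal.ofReal_mul (by norm_num)]
  apply ENNReal.ofReal_le_ofReal
  rw [mul_div_assoc', div_le_div_iff₀ (by positivity) (by positivity)]
  have : z ^ 2 ≤ 4 * w ^ 2 := by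
    rw [← sq_abs z, ← sq_abs w]; nlinarith [abs_nonneg z, abs_nonneg w]
  nlinarith [mul_pos hr (pow_pos hr 2)]

noncomputable def cP : ℝ≥0∞ := 4 * ENNReal.ofReal Real.pi

lemma pk_conv {r s : ℝ} (hr : 0 < r) (hs : 0 < s) (x x' : ℝ) :
    ∫⁻ y, pk r (x - y) * pk s (x' - y) ≤ cP * (pk r (x - x') + pk s (x - x')) := by
  have hp : ∀ y, pk r (x - y) * pk s (x' - y) ≤
      4 * pk r (x - x') * pk s (x' - y) + 4 * pk s (x - x') * pk r (x - y) := by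
    intro y
    rcases le_total (|x - x'| / 2) |x - y| with h | h
    · refine le_add_right ?_
      gcongr
      exact pk_far hr h
    · refine le_add_left ?_
      rw [mul_comm]
      gcongr
      refine pk_far hs ?_
      have := abs_sub_abs_le_abs_sub (x - x') (x - y)
      rw [show x - x' - (x - y) = -(x' - y) by ring, abs_neg] at this
      linarith
  refine (lintegral_mono hp).trans ?_
  have m1 : Measurable fun y => pk s (x' - y) := (pk_meas s).comp (by fun_prop)
  have m2 : Measurable fun y => pk r (x - y) := (pk_meas r).comp (by fun_prop)
  rw [lintegral_add_left (m1.const_mul _), lintegral_const_mul _ m1, lintegral_const_mul _ m2,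
    pk_lint' hr, pk_lint' hs]
  unfold cP
  apply le_of_eq; ring

end OC

namespace OC

lemma avg_l2 {r : ℝ} (hr : 0 < r) {h : ℝ → ℝ≥0∞} (hh : Measurable h) :
    ∫⁻ x, (∫⁻ y, pk r (x - y) * h y) ^ 2 ≤ ENNReal.ofReal Real.pi ^ 2 * ∫⁻ y, h y ^ 2 := by
  have hm : ∀ x, Measurable fun y => pk r (x - y) := fun x => (pk_meas r).comp (by fun_prop)
  have h1 : ∀ x, (∫⁻ y, pk r (x - y) * h y) ^ 2 ≤ ENNReal.ofReal Real.pi * ∫⁻ y, pk r (x - y) * h y ^ 2 := by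
    intro x
    have hw := cs (μ := volume.withDensity fun y => pk r (x - y)) (f := fun _ => 1) (g := h)
      aemeasurable_const hh.aemeasurable
    rw [lintegral_withDensity_eq_lintegral_mul _ (hm x) (by fun_prop),
      lintegral_withDensity_eq_lintegral_mul _ (hm x) (by fun_prop),
      lintegral_withDensity_eq_lintegral_mul _ (hm x) (by fun_prop)] at hw
    simpa [pk_lint' hr x] using hw
  refine (lintegral_mono h1).trans ?_
  have hm2 : Measurable (fun p : ℝ × ℝ => pk r (p.1 - p.2) * h p.2 ^ 2) :=
    ((pk_meas r).comp (by fun_prop)).mul ((hh.comp measurable_snd).pow_const 2)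
  rw [lintegral_const_mul _ hm2.lintegral_prod_right',
    lintegral_lintegral_swap hm2.aemeasurable]
  have : ∀ y, ∫⁻ x, pk r (x - y) * h y ^ 2 = ENNReal.ofReal Real.pi * h y ^ 2 := by
    intro y
    rw [lintegral_mul_const _ (show Measurable fun x => pk r (x - y) from (pk_meas r).comp (by fun_prop))]
    simp_rw [fun x => pk_comm r x y]
    rw [pk_lint' hr]
  simp_rw [this]
  rw [lintegral_const_mul _ (hh.pow_const 2)]
  apply le_of_eq; ring

/-- kernel linearised -/
lemma Lmeas {ρ : ℕ → ℝ} {s : ℝ → ℕ} (hs : Measurable s) :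
    Measurable (fun p : ℝ × ℝ => pk (ρ (s p.1)) (p.1 - p.2)) := by
  refine pk_meas2.comp (Measurable.prodMk ?_ (by fun_prop))
  exact (measurable_from_top (f := ρ)).comp (hs.comp measurable_fst)

lemma cP_ne_top : cP ≠ ⊤ := by unfold cP; finiteness

lemma sq_cancel {a b : ℝ≥0∞} (ha : a ≠ ⊤) (h : a ^ 2 ≤ b * a) : a ≤ b := by
  rcases eq_or_ne a 0 with rfl | h0
  · simp
  · rw [pow_two] at h
    exact (ENNReal.mul_le_mul_iff_left h0 ha).1 h

/-- self improvement -/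
lemma self_imp {ρ : ℕ → ℝ} (hρ : ∀ i, 0 < ρ i) {s : ℝ → ℕ} (hs : Measurable s) {N : ℝ} (hN : 0 ≤ N)
    (hyp : ∀ h : ℝ → ℝ≥0∞, Measurable h →
      ∫⁻ x, (∫⁻ y, pk (ρ (s x)) (x - y) * h y) ^ 2 ≤ ENNReal.ofReal (N ^ 2) * ∫⁻ y, h y ^ 2)
    (h : ℝ → ℝ≥0∞) (hh : Measurable h) :
      ∫⁻ x, (∫⁻ y, pk (ρ (s x)) (x - y) * h y) ^ 2 ≤ 2 * cP * ENNReal.ofReal N * ∫⁻ y, h y ^ 2 := by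
  have hL := Lmeas (ρ := ρ) hs
  set L : ℝ → ℝ → ℝ≥0∞ := fun x y => pk (ρ (s x)) (x - y) with hLdef
  have hL' : Measurable (fun p : ℝ × ℝ => L p.1 p.2) := hL
  have hLx : ∀ x, Measurable (fun y => L x y) := fun x => hL'.comp (measurable_const.prodMk measurable_id)
  have hLy : ∀ y, Measurable (fun x => L x y) := fun y => hL'.comp (measurable_id.prodMk measurable_const)
  have Tm : ∀ h : ℝ → ℝ≥0∞, Measurable h → Measurable (fun x => ∫⁻ y, L x y * h y) := by
    intro h hh
    exact (hL'.mul (hh.comp measurable_snd)).lintegral_prod_right'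
  set g : ℝ → ℝ≥0∞ := fun x => ∫⁻ y, L x y * h y with hg
  have gm : Measurable g := Tm h hh
  set G : ℝ → ℝ≥0∞ := fun y => ∫⁻ x, g x * L x y with hG
  have Gm : Measurable G := by
    exact ((gm.comp measurable_fst).mul hL').lintegral_prod_left'
  change ∫⁻ x, g x ^ 2 ≤ _
  rcases eq_or_ne (∫⁻ y, h y ^ 2) ⊤ with htop | hfin
  · rcases eq_or_ne N 0 with h0 | h0
    · have := hyp h hh
      simp only [h0, ne_eq, OfNat.ofNat_ne_zero, not_false_eq_true, zero_pow, ENNReal.ofReal_zero, zero_mul, nonpos_iff_eq_zero] at this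
      rw [show ∫⁻ x, g x ^ 2 = 0 from this]; exact zero_le
    · rw [htop, ENNReal.mul_top]
      · exact le_top
      · have : 0 < N := lt_of_le_of_ne hN (Ne.symm h0)
        unfold cP
        simp [this, Real.pi_pos]
  have gfin : ∫⁻ x, g x ^ 2 ≠ ⊤ := ne_top_of_le_ne_top (ENNReal.mul_ne_top ENNReal.ofReal_ne_top hfin) (hyp h hh)
  -- step 1
  have e1 : ∫⁻ x, g x ^ 2 = ∫⁻ y, h y * G y := by
    have : ∀ x, g x ^ 2 = ∫⁻ y, g x * (L x y * h y) := by
      intro x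
      rw [lintegral_const_mul _ (show Measurable fun y => L x y * h y from (hLx x).mul hh), pow_two]
    simp_rw [this]
    rw [lintegral_lintegral_swap]
    · refine lintegral_congr fun y => ?_
      rw [← lintegral_const_mul _ (show Measurable fun x => g x * L x y from gm.mul (hLy y))]
      refine lintegral_congr fun x => ?_
      ring
    · exact ((gm.comp measurable_fst).mul (hL'.mul (hh.comp measurable_snd))).aemeasurable
  -- step 2
  have e2 : ∫⁻ y, G y ^ 2 ≤ 2 * cP * ∫⁻ x, g x * ∫⁻ y, L x y * g y := by
    have a1 : ∀ y, G y ^ 2 = ∫⁻ p : ℝ × ℝ, (g p.1 * L p.1 y) * (g p.2 * L p.2 y) := by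
      intro y
      have m1 : Measurable fun x => g x * L x y := gm.mul (hL'.comp (measurable_id.prodMk measurable_const))
      rw [Measure.volume_eq_prod, lintegral_prod_mul m1.aemeasurable m1.aemeasurable, pow_two]
    simp_rw [a1]
    have m3 : Measurable (fun q : ℝ × (ℝ × ℝ) => (g q.2.1 * L q.2.1 q.1) * (g q.2.2 * L q.2.2 q.1)) := by
      have b1 : Measurable (fun q : ℝ × (ℝ × ℝ) => L q.2.1 q.1) :=
        hL'.comp (measurable_snd.fst.prodMk measurable_fst)
      have b2 : Measurable (fun q : ℝ × (ℝ × ℝ) => L q.2.2 q.1) :=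
        hL'.comp (measurable_snd.snd.prodMk measurable_fst)
      exact ((gm.comp measurable_snd.fst).mul b1).mul ((gm.comp measurable_snd.snd).mul b2)
    rw [lintegral_lintegral_swap m3.aemeasurable]
    have a2 : ∀ p : ℝ × ℝ, ∫⁻ y, (g p.1 * L p.1 y) * (g p.2 * L p.2 y) ≤
        cP * (g p.1 * (L p.1 p.2 * g p.2)) + cP * (g p.2 * (L p.2 p.1 * g p.1)) := by
      intro p
      have : ∀ y, (g p.1 * L p.1 y) * (g p.2 * L p.2 y) = (g p.1 * g p.2) * (L p.1 y * L p.2 y) := by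
        intro y; ring
      simp_rw [this]
      rw [lintegral_const_mul _ (show Measurable fun y => L p.1 y * L p.2 y from (hLx _).mul (hLx _))]
      have := pk_conv (hρ (s p.1)) (hρ (s p.2)) p.1 p.2
      calc _ ≤ g p.1 * g p.2 * (cP * (pk (ρ (s p.1)) (p.1 - p.2) + pk (ρ (s p.2)) (p.1 - p.2))) := by
            gcongr
        _ = _ := by
            rw [pk_comm (ρ (s p.2))]
            simp only [hLdef]; ring
    refine (lintegral_mono a2).trans ?_
    have m4 : Measurable (fun p : ℝ × ℝ => g p.1 * (L p.1 p.2 * g p.2)) :=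
      (gm.comp measurable_fst).mul (hL'.mul (gm.comp measurable_snd))
    have m5 : Measurable (fun p : ℝ × ℝ => g p.2 * (L p.2 p.1 * g p.1)) :=
      m4.comp measurable_swap
    rw [lintegral_add_left (m4.const_mul _), lintegral_const_mul _ m4, lintegral_const_mul _ m5]
    have e3 : ∫⁻ p : ℝ × ℝ, g p.1 * (L p.1 p.2 * g p.2) = ∫⁻ x, g x * ∫⁻ y, L x y * g y := by
      rw [Measure.volume_eq_prod, lintegral_prod _ m4.aemeasurable]
      refine lintegral_congr fun x => ?_
      dsimp only
      rw [lintegral_const_mul _ (show Measurable fun y => L x y * g y from (hLx x).mul gm)]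
    have e4 : ∫⁻ p : ℝ × ℝ, g p.2 * (L p.2 p.1 * g p.1) = ∫⁻ p : ℝ × ℝ, g p.1 * (L p.1 p.2 * g p.2) := by
      rw [Measure.volume_eq_prod, ← lintegral_prod_swap]
      rfl
    rw [e4, e3]
    apply le_of_eq; ring
  have e3 : ∫⁻ x, g x * ∫⁻ y, L x y * g y ≤ ENNReal.ofReal N * ∫⁻ x, g x ^ 2 := by
    have := cs (μ := volume) gm.aemeasurable (Tm g gm).aemeasurable
    have h2 := this.trans (mul_le_mul_right (hyp g gm) _)
    rw [← ENNReal.pow_le_pow_left_iff two_ne_zero]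
    refine h2.trans (le_of_eq ?_)
    rw [ENNReal.ofReal_pow hN]; ring
  have e4 := cs (μ := volume) hh.aemeasurable Gm.aemeasurable
  rw [← e1] at e4
  refine sq_cancel gfin (e4.trans ?_)
  calc _ ≤ (∫⁻ y, h y ^ 2) * (2 * cP * (ENNReal.ofReal N * ∫⁻ x, g x ^ 2)) := by
        gcongr; exact e2.trans (by gcongr)
    _ = _ := by ring

noncomputable def cM : ℝ := 2 * (4 * Real.pi) + 1

lemma cM_pos : 0 < cM := by unfold cM; positivity

lemma lin_bound {ρ : ℕ → ℝ} (hρ : ∀ i, 0 < ρ i) {s : ℝ → ℕ} (hs : Measurable s) (n : ℕ) (hn : ∀ x, s x ≤ n)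
    (h : ℝ → ℝ≥0∞) (hh : Measurable h) :
      ∫⁻ x, (∫⁻ y, pk (ρ (s x)) (x - y) * h y) ^ 2 ≤ ENNReal.ofReal (cM ^ 2) * ∫⁻ y, h y ^ 2 := by
  set S : Set ℝ := {N | 0 ≤ N ∧ ∀ h : ℝ → ℝ≥0∞, Measurable h →
      ∫⁻ x, (∫⁻ y, pk (ρ (s x)) (x - y) * h y) ^ 2 ≤ ENNReal.ofReal (N ^ 2) * ∫⁻ y, h y ^ 2} with hS
  have hne : S.Nonempty := by
    refine ⟨(n + 1) * Real.pi, by positivity, fun h hh => ?_⟩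
    have hm : ∀ i, Measurable fun x => ∫⁻ y, pk (ρ i) (x - y) * h y := by
      intro i
      have : Measurable (fun p : ℝ × ℝ => pk (ρ i) (p.1 - p.2) * h p.2) :=
        ((pk_meas _).comp (by fun_prop)).mul (hh.comp measurable_snd)
      exact this.lintegral_prod_right'
    calc ∫⁻ x, (∫⁻ y, pk (ρ (s x)) (x - y) * h y) ^ 2
        ≤ ∫⁻ x, ∑ i ∈ Finset.range (n + 1), (∫⁻ y, pk (ρ i) (x - y) * h y) ^ 2 := by
          refine lintegral_mono fun x => ?_
          exact Finset.single_le_sum (f := fun i => (∫⁻ y, pk (ρ i) (x - y) * h y) ^ 2)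
            (fun _ _ => zero_le) (Finset.mem_range.2 (Nat.lt_succ_of_le (hn x)))
      _ = ∑ i ∈ Finset.range (n + 1), ∫⁻ x, (∫⁻ y, pk (ρ i) (x - y) * h y) ^ 2 :=
          lintegral_finsetSum _ fun i _ => (hm i).pow_const 2
      _ ≤ ∑ i ∈ Finset.range (n + 1), ENNReal.ofReal Real.pi ^ 2 * ∫⁻ y, h y ^ 2 :=
          Finset.sum_le_sum fun i _ => avg_l2 (hρ i) hh
      _ ≤ ENNReal.ofReal (((n + 1) * Real.pi) ^ 2) * ∫⁻ y, h y ^ 2 := by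
          rw [Finset.sum_const, Finset.card_range, nsmul_eq_mul, ← mul_assoc, ← ENNReal.ofReal_pow Real.pi_pos.le,
            ← ENNReal.ofReal_natCast, ← ENNReal.ofReal_mul (by positivity)]
          gcongr
          push_cast
          have : (1:ℝ) ≤ n + 1 := by linarith [Nat.cast_nonneg (α := ℝ) n]
          nlinarith [sq_nonneg Real.pi, mul_nonneg (sub_nonneg.2 this) (sq_nonneg Real.pi), mul_pow ((n:ℝ)+1) Real.pi 2]
  have hbd : BddBelow S := ⟨0, fun N hN => hN.1⟩
  have himp : ∀ N ∈ S, Real.sqrt (8 * Real.pi * N) ∈ S := by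
    intro N hN
    refine ⟨Real.sqrt_nonneg _, fun h hh => ?_⟩
    have := self_imp hρ hs hN.1 hN.2 h hh
    rw [Real.sq_sqrt (mul_nonneg (by positivity) hN.1)]
    refine this.trans (le_of_eq ?_)
    congr 1
    unfold cP
    rw [ENNReal.ofReal_mul (by positivity), ENNReal.ofReal_mul (by positivity)]
    rw [show ENNReal.ofReal 8 = 8 by simp]
    ring
  have hle : sInf S < cM := by
    by_contra! hcon
    have hpi : 0 < 8 * Real.pi := by positivity
    have h1 : 8 * Real.pi < sInf S := by unfold cM at hcon; linarith
    have h2 : sInf S < sInf S ^ 2 / (8 * Real.pi) := by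
      rw [lt_div_iff₀ hpi]; nlinarith
    obtain ⟨N, hN, hN2⟩ := exists_lt_of_csInf_lt hne h2
    have h3 := csInf_le hbd (himp N hN)
    have h4 : Real.sqrt (8 * Real.pi * N) < sInf S := by
      rw [Real.sqrt_lt' (by linarith)]
      rw [lt_div_iff₀ hpi] at hN2; linarith
    linarith
  obtain ⟨N, hN, hN2⟩ := exists_lt_of_csInf_lt hne hle
  refine (hN.2 h hh).trans ?_
  gcongr
  exact hN.1

/-- The maximal function (dyadic Poisson). -/
noncomputable def PM (h : ℝ → ℝ≥0∞) (x : ℝ) : ℝ≥0∞ := ⨆ j : ℤ, ∫⁻ y, pk ((2 : ℝ) ^ j) (x - y) * h y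

lemma avg_meas (r : ℝ) {h : ℝ → ℝ≥0∞} (hh : Measurable h) : Measurable fun x => ∫⁻ y, pk r (x - y) * h y := by
  have : Measurable (fun p : ℝ × ℝ => pk r (p.1 - p.2) * h p.2) :=
    ((pk_meas _).comp (by fun_prop)).mul (hh.comp measurable_snd)
  exact this.lintegral_prod_right'

lemma PM_meas {h : ℝ → ℝ≥0∞} (hh : Measurable h) : Measurable (PM h) :=
  Measurable.iSup fun _ => avg_meas _ hh

theorem PM_bound {h : ℝ → ℝ≥0∞} (hh : Measurable h) :
    ∫⁻ x, PM h x ^ 2 ≤ ENNReal.ofReal (cM ^ 2) * ∫⁻ y, h y ^ 2 := by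
  obtain ⟨e, he⟩ := exists_surjective_nat ℤ
  have : ∀ x, PM h x = ⨆ i : ℕ, ∫⁻ y, pk ((2 : ℝ) ^ (e i)) (x - y) * h y := by
    intro x
    exact (he.iSup_comp (fun j : ℤ => ∫⁻ y, pk ((2 : ℝ) ^ j) (x - y) * h y)).symm
  simp_rw [this]
  refine sup_bound (fun i => avg_meas _ hh) fun n s hs hn => ?_
  exact lin_bound (ρ := fun i => (2 : ℝ) ^ (e i)) (fun i => by positivity) hs n hn h hh

end OC

namespace OC

noncomputable def er (β R z : ℝ) : ℝ := |z|⁻¹ * (min (|z| / R) (R / |z|)) ^ β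
noncomputable def ek (β R z : ℝ) : ℝ≥0∞ := ENNReal.ofReal (er β R z)

lemma ek_symm (β R z : ℝ) : ek β R (-z) = ek β R z := by simp [ek, er]

lemma ek_meas (β R : ℝ) : Measurable (ek β R) := by
  unfold ek er
  fun_prop

lemma er_nonneg (β : ℝ) {R : ℝ} (hR : 0 < R) (z : ℝ) : 0 ≤ er β R z := by
  unfold er
  have : 0 ≤ min (|z| / R) (R / |z|) := by positivity
  positivity

lemma summ_q {q : ℝ} (h0 : 0 ≤ q) (h1 : q < 1) : Summable (fun n : ℤ => q ^ n.natAbs) := by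
  apply Summable.of_nat_of_neg
  · simpa using summable_geometric_of_lt_one h0 h1
  · simpa using summable_geometric_of_lt_one h0 h1

lemma er_le {β : ℝ} (hβ : 0 < β) {R z : ℝ} {n j : ℤ} (hj : (2:ℝ) ^ j ≤ R) (hj' : R < 2 ^ (j + 1))
    (hn : (2:ℝ) ^ n ≤ |z|) (hn' : |z| < 2 ^ (n + 1)) :
    er β R z ≤ (5 * 2 ^ β * ((2:ℝ) ^ (-β)) ^ (n - j).natAbs) * ((2:ℝ) ^ n / ((2 ^ n) ^ 2 + z ^ 2)) := by
  have p1 : (0:ℝ) < 2 ^ n := by positivity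
  have p2 : (0:ℝ) < 2 ^ j := by positivity
  have hz : 0 < |z| := lt_of_lt_of_le p1 hn
  have hR : 0 < R := lt_of_lt_of_le p2 hj
  rw [zpow_add_one₀ two_ne_zero] at hj' hn'
  have a1 : |z|⁻¹ ≤ 5 * ((2:ℝ) ^ n / ((2 ^ n) ^ 2 + z ^ 2)) := by
    rw [inv_eq_one_div, mul_div_assoc', div_le_div_iff₀ hz (by positivity), ← sq_abs z]
    nlinarith
  have a2 : min (|z| / R) (R / |z|) ≤ 2 * (2:ℝ)⁻¹ ^ (n - j).natAbs := by
    rcases le_total n j with h | h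
    · refine (min_le_left _ _).trans ?_
      have : ((2:ℝ)⁻¹) ^ (n - j).natAbs = 2 ^ n / 2 ^ j := by
        rw [← zpow_natCast, Int.ofNat_natAbs_of_nonpos (by omega), inv_zpow', neg_neg, zpow_sub₀ two_ne_zero]
      rw [this, mul_div_assoc', div_le_div_iff₀ hR p2]
      nlinarith
    · refine (min_le_right _ _).trans ?_
      have : ((2:ℝ)⁻¹) ^ (n - j).natAbs = 2 ^ j / 2 ^ n := by
        rw [← zpow_natCast, Int.natAbs_of_nonneg (by omega), inv_zpow', neg_sub, zpow_sub₀ two_ne_zero]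
      rw [this, mul_div_assoc', div_le_div_iff₀ hz p1]
      nlinarith
  have a3 : (min (|z| / R) (R / |z|)) ^ β ≤ 2 ^ β * ((2:ℝ) ^ (-β)) ^ (n - j).natAbs := by
    have h0 : 0 ≤ min (|z| / R) (R / |z|) := by positivity
    refine (Real.rpow_le_rpow h0 a2 hβ.le).trans (le_of_eq ?_)
    rw [Real.mul_rpow (by norm_num) (by positivity), ← Real.rpow_natCast, ← Real.rpow_natCast,
      ← Real.rpow_mul (by norm_num), ← Real.rpow_mul (by norm_num), Real.inv_rpow (by norm_num),
      ← Real.rpow_neg (by norm_num)]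
    congr 2; ring
  unfold er
  calc _ ≤ (5 * ((2:ℝ) ^ n / ((2 ^ n) ^ 2 + z ^ 2))) * (2 ^ β * ((2:ℝ) ^ (-β)) ^ (n - j).natAbs) := by
        gcongr
    _ = _ := by ring

theorem ek_dom {β : ℝ} (hβ : 0 < β) : ∃ C : ℝ, 0 < C ∧ ∀ R : ℝ, 0 < R → ∀ h : ℝ → ℝ≥0∞, Measurable h →
    ∀ x, ∫⁻ y, ek β R (x - y) * h y ≤ ENNReal.ofReal C * PM h x := by
  set q : ℝ := (2:ℝ) ^ (-β) with hq
  have q0 : 0 ≤ q := by positivity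
  have q1 : q < 1 := Real.rpow_lt_one_of_one_lt_of_neg (by norm_num) (by linarith)
  have hs := (summ_q q0 q1).mul_left (5 * 2 ^ β)
  refine ⟨(∑' n : ℤ, 5 * 2 ^ β * q ^ n.natAbs) + 1, by
    have : 0 ≤ ∑' n : ℤ, 5 * (2:ℝ) ^ β * q ^ n.natAbs := tsum_nonneg fun n => by positivity
    linarith, fun R hR h hh x => ?_⟩
  obtain ⟨j, hj, hj'⟩ := exists_mem_Ico_zpow hR (one_lt_two)
  set c : ℤ → ℝ≥0∞ := fun n => ENNReal.ofReal (5 * 2 ^ β * q ^ (n - j).natAbs) with hc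
  have h1 : ∀ z, ek β R z ≤ ∑' n : ℤ, c n * pk ((2:ℝ) ^ n) z := by
    intro z
    rcases eq_or_ne z 0 with rfl | hz
    · simp [ek, er]
    · obtain ⟨n, hn, hn'⟩ := exists_mem_Ico_zpow (abs_pos.2 hz) (one_lt_two)
      refine le_trans ?_ (ENNReal.le_tsum n)
      simp only [hc, pk]
      rw [← ENNReal.ofReal_mul (by positivity)]
      exact ENNReal.ofReal_le_ofReal (er_le hβ hj hj' hn hn')
  have hm : ∀ n : ℤ, Measurable fun y => pk ((2:ℝ) ^ n) (x - y) * h y := fun n =>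
    ((pk_meas _).comp (by fun_prop)).mul hh
  calc ∫⁻ y, ek β R (x - y) * h y ≤ ∫⁻ y, ∑' n : ℤ, c n * (pk ((2:ℝ) ^ n) (x - y) * h y) := by
        refine lintegral_mono fun y => ?_
        simp_rw [← mul_assoc]
        rw [ENNReal.tsum_mul_right]
        gcongr
        exact h1 _
    _ = ∑' n : ℤ, c n * ∫⁻ y, (pk ((2:ℝ) ^ n) (x - y) * h y) := by
        rw [lintegral_tsum fun n => ((hm n).const_mul _).aemeasurable]
        congr 1; ext n; rw [lintegral_const_mul _ (hm n)]
    _ ≤ ∑' n : ℤ, c n * PM h x := by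
        gcongr with n
        exact le_iSup (fun j : ℤ => ∫⁻ y, pk ((2 : ℝ) ^ j) (x - y) * h y) n
    _ = (∑' n : ℤ, c n) * PM h x := ENNReal.tsum_mul_right
    _ ≤ _ := by
        gcongr
        have : ∑' n : ℤ, c n = ∑' n : ℤ, ENNReal.ofReal (5 * 2 ^ β * q ^ n.natAbs) :=
          (Equiv.subRight j).tsum_eq (fun n : ℤ => ENNReal.ofReal (5 * 2 ^ β * q ^ n.natAbs))
        rw [this, ← ENNReal.ofReal_tsum_of_nonneg (fun n => by positivity) hs]
        exact ENNReal.ofReal_le_ofReal (by linarith)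

end OC

namespace OC

lemma le_one_add_sq (a : ℝ≥0∞) : a ≤ 1 + a ^ 2 := by
  rcases le_total a 1 with h | h
  · exact h.trans le_self_add
  · refine le_trans ?_ le_add_self
    rw [pow_two]; exact le_mul_of_one_le_left zero_le h

lemma prod_fin {g : ℝ → ℂ} {M : ℝ≥0∞} {E : Set ℝ} (hE : MeasurableSet E)
    (hgb : ∀ x, ‖g x‖ₑ ≤ E.indicator (fun _ => M) x) : ∫⁻ x, ‖g x‖ₑ ≤ M * volume E := by
  refine (lintegral_mono hgb).trans ?_
  rw [lintegral_indicator_const hE]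

lemma X_norm {g : ℝ → ℂ} (hg : Measurable g) (hfin : ∫⁻ x, ‖g x‖ₑ ^ 2 ≠ ⊤) :
    ‖∫ x, (starRingEnd ℂ) (g x) * g x‖ₑ = ∫⁻ x, ‖g x‖ₑ ^ 2 := by
  have h1 : ∀ x, (starRingEnd ℂ) (g x) * g x = ((‖g x‖ ^ 2 : ℝ) : ℂ) := by
    intro x
    rw [Complex.conj_mul']; push_cast; rfl
  simp_rw [h1]
  rw [integral_complex_ofReal]
  have h2 : ∀ x, ‖g x‖ₑ ^ 2 = ENNReal.ofReal (‖g x‖ ^ 2) := by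
    intro x
    rw [ENNReal.ofReal_pow (norm_nonneg _), ofReal_norm]
  simp_rw [h2]
  have hi : Integrable (fun x => ‖g x‖ ^ 2) := by
    refine ⟨(hg.norm.pow_const 2).aestronglyMeasurable, ?_⟩
    unfold HasFiniteIntegral
    have : ∀ x, ‖‖g x‖ ^ 2‖ₑ = ‖g x‖ₑ ^ 2 := by intro x; simp
    simp_rw [this]
    exact lt_top_iff_ne_top.2 hfin
  rw [← ofReal_integral_eq_lintegral_ofReal hi (Eventually.of_forall fun x => by positivity)]
  rw [← ofReal_norm, Complex.norm_real, Real.norm_of_nonneg (integral_nonneg fun x => by positivity)]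

lemma G_bound {L : ℝ → ℝ → ℂ} (hL : Measurable fun p : ℝ × ℝ => L p.1 p.2) {g : ℝ → ℂ} (gm : Measurable g)
    {S : ℝ≥0∞} (hS : S ≠ ⊤) (hLS : ∀ x, ∫⁻ y, ‖L x y‖ₑ ^ 2 ≤ S) (hg1 : ∫⁻ x, ‖g x‖ₑ ≠ ⊤) :
    ∫⁻ y, ‖∫ x, (starRingEnd ℂ) (g x) * L x y‖ₑ ^ 2 ≤ ∫⁻ x, ∫⁻ x', ‖g x‖ₑ * ‖g x'‖ₑ * ‖∫ y, L x y * (starRingEnd ℂ) (L x' y)‖ₑ := by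
  set G : ℝ → ℂ := fun y => ∫ x, (starRingEnd ℂ) (g x) * L x y with hG
  have cjm : Measurable (fun z : ℂ => (starRingEnd ℂ) z) := Complex.continuous_conj.measurable
  have hLx : ∀ x, Measurable (fun y => L x y) := fun x => hL.comp (measurable_const.prodMk measurable_id)
  have Gm : Measurable G := by
    have : StronglyMeasurable (fun p : ℝ × ℝ => (starRingEnd ℂ) (g p.2) * L p.2 p.1) :=
      ((cjm.comp (gm.comp measurable_snd)).mul (hL.comp measurable_swap)).stronglyMeasurable
    exact this.integral_prod_right'.measurable
  set H : ℝ × (ℝ × ℝ) → ℂ := fun q => ((starRingEnd ℂ) (g q.2.1) * L q.2.1 q.1) * (g q.2.2 * (starRingEnd ℂ) (L q.2.2 q.1)) with hH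
  have Hm : Measurable H := by
    have b1 : Measurable (fun q : ℝ × (ℝ × ℝ) => L q.2.1 q.1) :=
      hL.comp (measurable_snd.fst.prodMk measurable_fst)
    have b2 : Measurable (fun q : ℝ × (ℝ × ℝ) => L q.2.2 q.1) :=
      hL.comp (measurable_snd.snd.prodMk measurable_fst)
    exact ((cjm.comp (gm.comp measurable_snd.fst)).mul b1).mul ((gm.comp measurable_snd.snd).mul (cjm.comp b2))
  have eg : ∀ w : ℂ, ‖(starRingEnd ℂ) w‖ₑ = ‖w‖ₑ := by intro w; rw [← ofReal_norm, RCLike.norm_conj, ofReal_norm]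
  have inner : ∀ x x', ∫⁻ y, ‖L x y‖ₑ * ‖L x' y‖ₑ ≤ 1 + S * S := by
    intro x x'
    refine (le_one_add_sq _).trans ?_
    gcongr
    exact (cs (hLx x).enorm.aemeasurable (hLx x').enorm.aemeasurable).trans (mul_le_mul' (hLS x) (hLS x'))
  have Hi : Integrable H := by
    refine ⟨Hm.aestronglyMeasurable, ?_⟩
    unfold HasFiniteIntegral
    rw [Measure.volume_eq_prod, lintegral_prod_symm _ Hm.enorm.aemeasurable]
    have : ∀ p : ℝ × ℝ, ∫⁻ y, ‖H (y, p)‖ₑ ≤ (1 + S * S) * (‖g p.1‖ₑ * ‖g p.2‖ₑ) := by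
      intro p
      have : ∀ y, ‖H (y, p)‖ₑ = (‖g p.1‖ₑ * ‖g p.2‖ₑ) * (‖L p.1 y‖ₑ * ‖L p.2 y‖ₑ) := by
        intro y
        simp only [hH, enorm_mul, eg]; ring
      simp_rw [this]
      rw [lintegral_const_mul _ (show Measurable fun y => ‖L p.1 y‖ₑ * ‖L p.2 y‖ₑ from (hLx _).enorm.mul (hLx _).enorm), mul_comm]
      gcongr
      exact inner _ _
    refine lt_of_le_of_lt (lintegral_mono this) ?_
    have m2 : Measurable fun p : ℝ × ℝ => ‖g p.1‖ₑ * ‖g p.2‖ₑ :=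
      (gm.comp measurable_fst).enorm.mul (gm.comp measurable_snd).enorm
    rw [lintegral_const_mul _ m2, Measure.volume_eq_prod, lintegral_prod_mul gm.enorm.aemeasurable gm.enorm.aemeasurable]
    exact lt_top_iff_ne_top.2 (by finiteness)
  have hGG : ∀ y, ∫ p, H (y, p) = (starRingEnd ℂ) ((starRingEnd ℂ) (G y)) * (starRingEnd ℂ) (G y) := by
    intro y
    simp only [hH]
    rw [Measure.volume_eq_prod, integral_prod_mul (fun x => (starRingEnd ℂ) (g x) * L x y) (fun x => g x * (starRingEnd ℂ) (L x y))]
    rw [Complex.conj_conj]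
    congr 1
    rw [hG, ← integral_conj]
    simp
  have Gi := Hi.integral_prod_left
  have hfin : ∫⁻ y, ‖(starRingEnd ℂ) (G y)‖ₑ ^ 2 ≠ ⊤ := by
    have := Gi.2
    unfold HasFiniteIntegral at this
    simp_rw [hGG, enorm_mul, eg] at this
    simp_rw [eg, pow_two]
    exact this.ne
  have hX := X_norm (cjm.comp Gm) hfin
  simp only [Function.comp_def, eg] at hX
  rw [← hX]
  simp_rw [← hGG]
  rw [integral_integral_swap (f := fun y p => H (y, p)) Hi]
  refine (enorm_integral_le_lintegral_enorm _).trans ?_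
  have e1 : ∀ p : ℝ × ℝ, ‖∫ y, H (y, p)‖ₑ = ‖g p.1‖ₑ * ‖g p.2‖ₑ * ‖∫ y, L p.1 y * (starRingEnd ℂ) (L p.2 y)‖ₑ := by
    intro p
    have : ∀ y, H (y, p) = ((starRingEnd ℂ) (g p.1) * g p.2) * (L p.1 y * (starRingEnd ℂ) (L p.2 y)) := by
      intro y; simp only [hH]; ring
    simp_rw [this]
    rw [integral_const_mul, enorm_mul, enorm_mul, eg]
  simp_rw [e1]
  rw [Measure.volume_eq_prod, lintegral_prod]
  refine ((gm.comp measurable_fst).enorm.mul (gm.comp measurable_snd).enorm).aemeasurable.mul ?_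
  have : StronglyMeasurable (fun q : (ℝ × ℝ) × ℝ => L q.1.1 q.2 * (starRingEnd ℂ) (L q.1.2 q.2)) := by
    have b1 : Measurable (fun q : (ℝ × ℝ) × ℝ => L q.1.1 q.2) :=
      hL.comp (measurable_fst.fst.prodMk measurable_snd)
    have b2 : Measurable (fun q : (ℝ × ℝ) × ℝ => L q.1.2 q.2) :=
      hL.comp (measurable_fst.snd.prodMk measurable_snd)
    exact (b1.mul (cjm.comp b2)).stronglyMeasurable
  exact this.integral_prod_right'.measurable.enorm.aemeasurable

end OC

namespace OC

set_option maxHeartbeats 1000000 in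
theorem ttstar {K : ℕ → ℝ → ℂ} (hK : ∀ i, Measurable (K i)) (hK2 : ∀ i, ∫⁻ y, ‖K i y‖ₑ ^ 2 ≠ ⊤)
    {J : ℕ → ℝ → ℝ≥0∞} (hJm : ∀ i, Measurable (J i)) (hJs : ∀ i z, J i (-z) = J i z) {D : ℝ≥0∞}
    (hJK : ∀ i j z, z ≠ 0 → ‖∫ y, K i y * (starRingEnd ℂ) (K j (y - z))‖ₑ ≤ J i z + J j z)
    (hJM : ∀ h : ℝ → ℝ≥0∞, Measurable h → ∀ i x, ∫⁻ y, J i (x - y) * h y ≤ D * PM h x)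
    {f : ℝ → ℂ} (hf : Measurable f) (hf2 : ∫⁻ y, ‖f y‖ₑ ^ 2 ≠ ⊤) :
    ∫⁻ x, (⨆ i, ‖∫ y, K i (x - y) * f y‖ₑ) ^ 2 ≤ 2 * D * ENNReal.ofReal cM * ∫⁻ y, ‖f y‖ₑ ^ 2 := by
  have eg : ∀ w : ℂ, ‖(starRingEnd ℂ) w‖ₑ = ‖w‖ₑ := by intro w; rw [← ofReal_norm, RCLike.norm_conj, ofReal_norm]
  have cjm : Measurable (fun z : ℂ => (starRingEnd ℂ) z) := Complex.continuous_conj.measurable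
  have um : ∀ i, Measurable fun x => ∫ y, K i (x - y) * f y := by
    intro i
    have : StronglyMeasurable (fun p : ℝ × ℝ => K i (p.1 - p.2) * f p.2) :=
      (((hK i).comp (by fun_prop)).mul (hf.comp measurable_snd)).stronglyMeasurable
    exact this.integral_prod_right'.measurable
  refine sup_bound (fun i => (um i).enorm) fun n s hs hsn => ?_
  set u : ℝ → ℂ := fun x => ∫ y, K (s x) (x - y) * f y with hu
  have umm : Measurable u := meas_sel um hs
  set L : ℝ → ℝ → ℂ := fun x y => K (s x) (x - y) with hLd
  have KK : Measurable (fun p : ℕ × ℝ => K p.1 p.2) :=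
    measurable_from_prod_countable_right (fun n => hK n)
  have JJ : Measurable (fun p : ℕ × ℝ => J p.1 p.2) :=
    measurable_from_prod_countable_right (fun n => hJm n)
  have hL : Measurable fun p : ℝ × ℝ => L p.1 p.2 :=
    KK.comp ((hs.comp measurable_fst).prodMk (measurable_fst.sub measurable_snd))
  have hJ2 : Measurable fun p : ℝ × ℝ => J (s p.1) (p.1 - p.2) :=
    JJ.comp ((hs.comp measurable_fst).prodMk (measurable_fst.sub measurable_snd))
  have hLx : ∀ x, Measurable (fun y => L x y) := fun x => hL.comp (measurable_const.prodMk measurable_id)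
  have hLy : ∀ y, Measurable (fun x => L x y) := fun y => hL.comp (measurable_id.prodMk measurable_const)
  have hJx : ∀ x, Measurable (fun y => J (s x) (x - y)) := fun x => hJ2.comp (measurable_const.prodMk measurable_id)
  set S : ℝ≥0∞ := ∑ i ∈ Finset.range (n + 1), ∫⁻ y, ‖K i y‖ₑ ^ 2 with hSd
  have hS : S ≠ ⊤ := by
    rw [hSd]; exact ENNReal.sum_ne_top.2 fun i _ => hK2 i
  have hLS : ∀ x, ∫⁻ y, ‖L x y‖ₑ ^ 2 ≤ S := by
    intro x
    simp only [hLd]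
    rw [lintegral_sub_left_eq_self (fun y => ‖K (s x) y‖ₑ ^ 2) x]
    exact Finset.single_le_sum (f := fun i => ∫⁻ y, ‖K i y‖ₑ ^ 2) (fun _ _ => zero_le)
      (Finset.mem_range.2 (Nat.lt_succ_of_le (hsn x)))
  set B : ℝ≥0∞ := 1 + S * ∫⁻ y, ‖f y‖ₑ ^ 2 with hB
  have hBt : B ≠ ⊤ := by rw [hB]; finiteness
  have vb : ∀ x, ∫⁻ y, ‖L x y‖ₑ * ‖f y‖ₑ ≤ B := by
    intro x
    refine (le_one_add_sq _).trans ?_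
    rw [hB]
    gcongr
    exact (cs (hLx x).enorm.aemeasurable hf.enorm.aemeasurable).trans (by gcongr; exact hLS x)
  have ub : ∀ x, ‖u x‖ₑ ≤ B := by
    intro x
    refine (enorm_integral_le_lintegral_enorm _).trans (le_trans (le_of_eq ?_) (vb x))
    simp_rw [enorm_mul]; rfl
  -- key
  have key : ∀ m : ℕ, ∫⁻ x in Icc (-(m:ℝ)) m, ‖u x‖ₑ ^ 2 ≤ 2 * D * ENNReal.ofReal cM * ∫⁻ y, ‖f y‖ₑ ^ 2 := by
    intro m
    set E : Set ℝ := Icc (-(m:ℝ)) m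
    have hE : MeasurableSet E := measurableSet_Icc
    have hEv : volume E ≠ ⊤ := by simp [E]
    set g : ℝ → ℂ := E.indicator u with hg
    have gm : Measurable g := umm.indicator hE
    have gb : ∀ x, ‖g x‖ₑ ≤ E.indicator (fun _ => B) x := by
      intro x
      by_cases hx : x ∈ E <;> simp [hg, hx, ub x]
    have gb' : ∀ x, ‖g x‖ₑ ≤ B := fun x => (gb x).trans (by by_cases hx : x ∈ E <;> simp [hx])
    have g1 : ∫⁻ x, ‖g x‖ₑ ≠ ⊤ := ne_top_of_le_ne_top (ENNReal.mul_ne_top hBt hEv) (prod_fin hE gb)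
    have X0 : ∫⁻ x in E, ‖u x‖ₑ ^ 2 = ∫⁻ x, ‖g x‖ₑ ^ 2 := by
      rw [← lintegral_indicator hE]
      refine lintegral_congr fun x => ?_
      by_cases hx : x ∈ E <;> simp [hg, hx]
    rw [X0]
    have Xfin : ∫⁻ x, ‖g x‖ₑ ^ 2 ≠ ⊤ := by
      refine ne_top_of_le_ne_top (ENNReal.mul_ne_top hBt g1) ?_
      rw [← lintegral_const_mul _ gm.enorm]
      refine lintegral_mono fun x => ?_
      rw [pow_two]
      dsimp only
      gcongr
      exact gb' x
    set X := ∫⁻ x, ‖g x‖ₑ ^ 2 with hX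
    set G : ℝ → ℂ := fun y => ∫ x, (starRingEnd ℂ) (g x) * L x y with hG
    have Gm : Measurable G := by
      have : StronglyMeasurable (fun p : ℝ × ℝ => (starRingEnd ℂ) (g p.2) * L p.2 p.1) :=
        ((cjm.comp (gm.comp measurable_snd)).mul (hL.comp measurable_swap)).stronglyMeasurable
      exact this.integral_prod_right'.measurable
    -- duality
    have d1 : X ≤ ∫⁻ y, ‖f y‖ₑ * ‖G y‖ₑ := by
      rw [hX, ← X_norm gm Xfin]
      have a1 : ∀ x, (starRingEnd ℂ) (g x) * g x = ∫ y, (starRingEnd ℂ) (g x) * (L x y * f y) := by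
        intro x
        rw [integral_const_mul]
        by_cases hx : x ∈ E
        · congr 1
          simp only [hg, hx, indicator_of_mem, hu]; rfl
        · simp [hg, hx]
      simp_rw [a1]
      rw [integral_integral_swap]
      · refine (enorm_integral_le_lintegral_enorm _).trans (le_of_eq ?_)
        refine lintegral_congr fun y => ?_
        rw [← enorm_mul]
        congr 1
        simp only [hG]
        rw [← integral_const_mul]
        refine integral_congr_ae (Eventually.of_forall fun x => ?_)
        dsimp only
        ring
      · have mm : Measurable (fun p : ℝ × ℝ => (starRingEnd ℂ) (g p.1) * (L p.1 p.2 * f p.2)) :=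
          (cjm.comp (gm.comp measurable_fst)).mul (hL.mul (hf.comp measurable_snd))
        refine ⟨mm.aestronglyMeasurable, ?_⟩
        unfold HasFiniteIntegral
        have mm' : Measurable (Function.uncurry fun x y => (starRingEnd ℂ) (g x) * (L x y * f y)) := mm
        rw [lintegral_prod _ mm'.enorm.aemeasurable]
        have : ∀ x, ∫⁻ y, ‖Function.uncurry (fun x y => (starRingEnd ℂ) (g x) * (L x y * f y)) (x, y)‖ₑ ≤ B * ‖g x‖ₑ := by
          intro x
          simp only [Function.uncurry, enorm_mul, eg]
          rw [lintegral_const_mul _ (show Measurable fun y => ‖L x y‖ₑ * ‖f y‖ₑ from (hLx x).enorm.mul hf.enorm), mul_comm]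
          gcongr
          exact vb x
        refine lt_of_le_of_lt (lintegral_mono this) ?_
        rw [lintegral_const_mul _ gm.enorm]
        exact lt_top_iff_ne_top.2 (by finiteness)
    have d2 : X ^ 2 ≤ (∫⁻ y, ‖f y‖ₑ ^ 2) * ∫⁻ y, ‖G y‖ₑ ^ 2 :=
      (pow_le_pow_left' d1 2).trans (cs hf.enorm.aemeasurable Gm.enorm.aemeasurable)
    set gg : ℝ → ℝ≥0∞ := fun x => ‖g x‖ₑ with hgg
    have ggm : Measurable gg := gm.enorm
    have d3 : ∫⁻ y, ‖G y‖ₑ ^ 2 ≤ 2 * D * ENNReal.ofReal cM * X := by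
      refine (G_bound hL gm hS hLS g1).trans ?_
      have a1 : ∀ x x', x' ≠ x → ‖∫ y, L x y * (starRingEnd ℂ) (L x' y)‖ₑ ≤ J (s x) (x - x') + J (s x') (x' - x) := by
        intro x x' hne
        have := hJK (s x) (s x') (x - x') (sub_ne_zero.2 hne.symm)
        rw [← hJs (s x') (x' - x), neg_sub]
        refine le_trans (le_of_eq ?_) this
        congr 1
        rw [← integral_sub_left_eq_self (fun y => K (s x) y * (starRingEnd ℂ) (K (s x') (y - (x - x')))) volume x]
        refine integral_congr_ae (Eventually.of_forall fun y => ?_)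
        simp only [hLd]
        congr 3
        ring
      have a2 : ∀ x, ∫⁻ x', ‖g x‖ₑ * ‖g x'‖ₑ * ‖∫ y, L x y * (starRingEnd ℂ) (L x' y)‖ₑ
          ≤ ∫⁻ x', (gg x * (J (s x) (x - x') * gg x') + gg x' * (J (s x') (x' - x) * gg x)) := by
        intro x
        refine lintegral_mono_ae ?_
        have : ∀ᵐ x' : ℝ, x' ≠ x := by
          simp [ae_iff]
        filter_upwards [this] with x' hx'
        refine (mul_le_mul_right (a1 x x' hx') _).trans (le_of_eq ?_)
        simp only [hgg]; ring
      refine (lintegral_mono a2).trans ?_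
      have m4 : Measurable (fun p : ℝ × ℝ => gg p.1 * (J (s p.1) (p.1 - p.2) * gg p.2)) :=
        (ggm.comp measurable_fst).mul (hJ2.mul (ggm.comp measurable_snd))
      have m5 : Measurable (fun p : ℝ × ℝ => gg p.2 * (J (s p.2) (p.2 - p.1) * gg p.1)) :=
        m4.comp measurable_swap
      have a3 : ∀ x, ∫⁻ x', (gg x * (J (s x) (x - x') * gg x') + gg x' * (J (s x') (x' - x) * gg x))
         = (∫⁻ x', gg x * (J (s x) (x - x') * gg x')) + ∫⁻ x', gg x' * (J (s x') (x' - x) * gg x) := by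
        intro x
        have m6 : Measurable (fun x' => gg x * (J (s x) (x - x') * gg x')) := ((hJx x).mul ggm).const_mul _
        exact lintegral_add_left m6 _
      simp_rw [a3]
      rw [lintegral_add_left m4.lintegral_prod_right']
      rw [lintegral_lintegral_swap (f := fun x x' => gg x' * (J (s x') (x' - x) * gg x)) m5.aemeasurable, ← two_mul]
      have a4 : ∫⁻ x, ∫⁻ x', gg x * (J (s x) (x - x') * gg x') ≤ D * ∫⁻ x, gg x * PM gg x := by
        rw [← lintegral_const_mul _ (show Measurable fun x => gg x * PM gg x from ggm.mul (PM_meas ggm))]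
        refine lintegral_mono fun x => ?_
        rw [lintegral_const_mul _ (show Measurable fun y => J (s x) (x - y) * gg y from (hJx x).mul ggm)]
        refine (mul_le_mul_right (hJM gg ggm (s x) x) _).trans (le_of_eq ?_)
        ring
      have a5 : ∫⁻ x, gg x * PM gg x ≤ ENNReal.ofReal cM * X := by
        have := cs (μ := volume) ggm.aemeasurable (PM_meas ggm).aemeasurable
        rw [← ENNReal.pow_le_pow_left_iff two_ne_zero]
        refine (this.trans (mul_le_mul_right (PM_bound ggm) _)).trans (le_of_eq ?_)
        rw [ENNReal.ofReal_pow cM_pos.le]; simp only [hX, hgg]; ring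
      calc _ ≤ 2 * (D * (ENNReal.ofReal cM * X)) := by gcongr; exact a4.trans (by gcongr)
        _ = _ := by ring
    refine sq_cancel Xfin (d2.trans ?_)
    refine (mul_le_mul_right d3 _).trans (le_of_eq ?_)
    ring
  have cov : AECover volume atTop (fun m : ℕ => Icc (-(m:ℝ)) m) :=
    aecover_Icc (tendsto_neg_atTop_atBot.comp tendsto_natCast_atTop_atTop) tendsto_natCast_atTop_atTop
  exact le_of_tendsto' (cov.lintegral_tendsto_of_countably_generated (umm.enorm.pow_const 2).aemeasurable) key

end OC

namespace OC

noncomputable def Qk (r y : ℝ) : ℝ := y / (y ^ 2 + r ^ 2)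

lemma Qk_meas (r : ℝ) : Measurable (Qk r) := by unfold Qk; fun_prop

lemma Qk_sq {r : ℝ} (hr : 0 < r) (y : ℝ) : Qk r y ^ 2 ≤ r⁻¹ * (r / (r ^ 2 + y ^ 2)) := by
  unfold Qk
  have h : 0 < y ^ 2 + r ^ 2 := by positivity
  rw [show r⁻¹ * (r / (r ^ 2 + y ^ 2)) = 1 / (y ^ 2 + r ^ 2) by field_simp; ring, div_pow,
    div_le_div_iff₀ (by positivity) h]
  nlinarith [sq_nonneg r, sq_nonneg (y * r), mul_nonneg (sq_nonneg r) h.le]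

lemma Qk_sq_int {r : ℝ} (hr : 0 < r) : Integrable (fun y => Qk r y ^ 2) := by
  refine ((integrable_pois hr).const_mul r⁻¹).mono' ((Qk_meas r).pow_const 2).aestronglyMeasurable
    (Eventually.of_forall fun y => ?_)
  rw [Real.norm_of_nonneg (by positivity)]
  exact Qk_sq hr y

lemma QQ_int {r s : ℝ} (hr : 0 < r) (hs : 0 < s) (z : ℝ) : Integrable (fun y => Qk r y * Qk s (y - z)) := by
  refine ((Qk_sq_int hr).add ((Qk_sq_int hs).comp_sub_right z)).mono'
    ((Qk_meas r).mul ((Qk_meas s).comp (by fun_prop))).aestronglyMeasurable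
    (Eventually.of_forall fun y => ?_)
  simp only [Pi.add_apply, norm_mul, Real.norm_eq_abs]
  rw [← sq_abs (Qk r y), ← sq_abs (Qk s (y - z))]
  nlinarith [sq_nonneg (|Qk r y| - |Qk s (y - z)|), sq_nonneg (|Qk r y|), sq_nonneg (|Qk s (y - z)|)]

lemma log_lim {r s : ℝ} (hr : 0 < r) (hs : 0 < s) (z : ℝ) {l : Filter ℝ} (hl : l = atTop ∨ l = atBot) :
    Tendsto (fun y : ℝ => Real.log (y ^ 2 + r ^ 2) - Real.log ((y - z) ^ 2 + s ^ 2)) l (𝓝 0) := by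
  have h1 : Tendsto (fun y : ℝ => y⁻¹) l (𝓝 0) := by
    rcases hl with rfl | rfl
    · exact tendsto_inv_atTop_zero
    · exact tendsto_inv_atBot_zero
  have hne : ∀ᶠ y : ℝ in l, y ≠ 0 := by
    rcases hl with rfl | rfl
    · exact eventually_ne_atTop 0
    · exact eventually_ne_atBot 0
  have h2 : Tendsto (fun y : ℝ => Real.log (1 + r ^ 2 * y⁻¹ ^ 2) - Real.log ((1 - z * y⁻¹) ^ 2 + s ^ 2 * y⁻¹ ^ 2)) l (𝓝 (Real.log (1 + r ^ 2 * 0 ^ 2) - Real.log ((1 - z * 0) ^ 2 + s ^ 2 * 0 ^ 2))) := by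
    refine Tendsto.sub (Tendsto.log ?_ (by norm_num)) (Tendsto.log ?_ (by norm_num))
    · exact tendsto_const_nhds.add ((h1.pow 2).const_mul _)
    · exact ((tendsto_const_nhds.sub (h1.const_mul _)).pow 2).add ((h1.pow 2).const_mul _)
  rw [show (0:ℝ) = Real.log (1 + r ^ 2 * 0 ^ 2) - Real.log ((1 - z * 0) ^ 2 + s ^ 2 * 0 ^ 2) by norm_num]
  refine h2.congr' ?_
  filter_upwards [hne] with y hy
  rw [← Real.log_div, ← Real.log_div]
  · congr 1
    field_simp
  all_goals positivity

lemma atan_lim_top {r : ℝ} (hr : 0 < r) (z : ℝ) : Tendsto (fun y : ℝ => Real.arctan ((y - z) / r)) atTop (𝓝 (Real.pi / 2)) := by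
  refine (tendsto_nhds_of_tendsto_nhdsWithin Real.tendsto_arctan_atTop).comp ?_
  refine Tendsto.atTop_div_const hr ?_
  exact tendsto_atTop_add_const_right _ (-z) tendsto_id

lemma atan_lim_bot {r : ℝ} (hr : 0 < r) (z : ℝ) : Tendsto (fun y : ℝ => Real.arctan ((y - z) / r)) atBot (𝓝 (-(Real.pi / 2))) := by
  refine (tendsto_nhds_of_tendsto_nhdsWithin Real.tendsto_arctan_atBot).comp ?_
  refine Tendsto.atBot_div_const hr ?_
  exact tendsto_atBot_add_const_right _ (-z) tendsto_id

lemma QQ {r s z : ℝ} (hr : 0 < r) (hs : 0 < s) (hz : z ≠ 0) :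
    ∫ y, Qk r y * Qk s (y - z) = Real.pi * ((r + s) / ((r + s) ^ 2 + z ^ 2)) := by
  set W := ((r + s) ^ 2 + z ^ 2) * ((r - s) ^ 2 + z ^ 2) with hW
  have hz2 : 0 < z ^ 2 := by positivity
  have hWp : 0 < W := by positivity
  set α := -z * (z ^ 2 + s ^ 2 + r ^ 2) / W with hα
  set β := r ^ 2 * (r ^ 2 - s ^ 2 + z ^ 2) / W with hβ
  set κ := s ^ 2 * (s ^ 2 - r ^ 2 + z ^ 2) / W with hκ
  have hsum : β / r + κ / s = (r + s) / ((r + s) ^ 2 + z ^ 2) := by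
    have h2 : (r - s) ^ 2 + z ^ 2 ≠ 0 := by positivity
    rw [hβ, hκ, hW]
    field_simp
    ring
  have pf : ∀ y, y * (y - z) = (α * y + β) * ((y - z) ^ 2 + s ^ 2) + (-α * (y - z) + κ) * (y ^ 2 + r ^ 2) := by
    intro y
    rw [hα, hβ, hκ]
    field_simp
    rw [hW]
    ring
  set F : ℝ → ℝ := fun y => (α / 2) * (Real.log (y ^ 2 + r ^ 2) - Real.log ((y - z) ^ 2 + s ^ 2))
    + ((β / r) * Real.arctan ((y - 0) / r) + (κ / s) * Real.arctan ((y - z) / s)) with hF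
  have hd : ∀ y, HasDerivAt F (Qk r y * Qk s (y - z)) y := by
    intro y
    have p1 : 0 < y ^ 2 + r ^ 2 := by positivity
    have p2 : 0 < (y - z) ^ 2 + s ^ 2 := by positivity
    have p1' : 0 < r ^ 2 + y ^ 2 := by positivity
    have p2' : 0 < s ^ 2 + (y - z) ^ 2 := by positivity
    have d1 : HasDerivAt (fun y : ℝ => y ^ 2 + r ^ 2) (2 * y) y := by
      simpa using (hasDerivAt_pow 2 y).add_const (r ^ 2)
    have d0 : HasDerivAt (fun y : ℝ => y - z) 1 y := (hasDerivAt_id y).sub_const z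
    have d2 : HasDerivAt (fun y : ℝ => (y - z) ^ 2 + s ^ 2) (2 * (y - z)) y := by
      simpa using (d0.pow 2).add_const (s ^ 2)
    have d3 := ((((hasDerivAt_id y).sub_const 0).div_const r).arctan).const_mul (β / r)
    have d4 := ((d0.div_const s).arctan).const_mul (κ / s)
    have := (((d1.log p1.ne').sub (d2.log p2.ne')).const_mul (α / 2)).add (d3.add d4)
    refine this.congr_deriv ?_
    unfold Qk
    rw [div_mul_div_comm y, pf y]
    simp only [id, sub_zero]
    rw [show (1:ℝ) + (y / r) ^ 2 = (y ^ 2 + r ^ 2) / r ^ 2 by field_simp; ring,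
      show (1:ℝ) + ((y - z) / s) ^ 2 = ((y - z) ^ 2 + s ^ 2) / s ^ 2 by field_simp; ring]
    field_simp
    ring
  have ht : Tendsto F atTop (𝓝 ((α / 2) * 0 + ((β / r) * (Real.pi / 2) + (κ / s) * (Real.pi / 2)))) :=
    ((log_lim hr hs z (Or.inl rfl)).const_mul _).add (((atan_lim_top hr 0).const_mul _).add ((atan_lim_top hs z).const_mul _))
  have hb : Tendsto F atBot (𝓝 ((α / 2) * 0 + ((β / r) * (-(Real.pi / 2)) + (κ / s) * (-(Real.pi / 2))))) :=
    ((log_lim hr hs z (Or.inr rfl)).const_mul _).add (((atan_lim_bot hr 0).const_mul _).add ((atan_lim_bot hs z).const_mul _))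
  rw [integral_of_hasDerivAt_of_tendsto hd (QQ_int hr hs z) hb ht, ← hsum]
  ring

lemma QQ_le {r s z : ℝ} (hr : 0 < r) (hs : 0 < s) :
    (r + s) / ((r + s) ^ 2 + z ^ 2) ≤ r / (r ^ 2 + z ^ 2) + s / (s ^ 2 + z ^ 2) := by
  rw [add_div]
  gcongr <;> nlinarith

theorem hilb {f : ℝ → ℂ} (hf : Measurable f) (hf2 : ∫⁻ y, ‖f y‖ₑ ^ 2 ≠ ⊤) :
    ∫⁻ x, (⨆ j : ℤ, ‖∫ y, ((Qk (2 ^ j) (x - y) : ℝ) : ℂ) * f y‖ₑ) ^ 2 ≤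
      2 * ENNReal.ofReal Real.pi * ENNReal.ofReal cM * ∫⁻ y, ‖f y‖ₑ ^ 2 := by
  obtain ⟨e, he⟩ := exists_surjective_nat ℤ
  have h2 : ∀ i, (0:ℝ) < 2 ^ (e i) := fun i => by positivity
  have := ttstar (K := fun i y => ((Qk (2 ^ (e i)) y : ℝ) : ℂ)) (J := fun i z => ENNReal.ofReal Real.pi * pk (2 ^ (e i)) z)
    (D := ENNReal.ofReal Real.pi) (fun i => Complex.measurable_ofReal.comp (Qk_meas _)) ?_ (fun i => (pk_meas _).const_mul _) ?_ ?_ ?_ hf hf2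
  · refine le_trans (le_of_eq ?_) this
    refine lintegral_congr fun x => ?_
    congr 1
    exact (he.iSup_comp (fun j => ‖∫ y, ((Qk (2 ^ j) (x - y) : ℝ) : ℂ) * f y‖ₑ)).symm
  · intro i
    have := (Qk_sq_int (h2 i)).2
    unfold HasFiniteIntegral at this
    refine ne_of_lt (lt_of_le_of_lt (le_of_eq ?_) this)
    refine lintegral_congr fun x => ?_
    rw [enorm_pow]
    congr 1
    rw [← ofReal_norm, ← ofReal_norm, Complex.norm_real]
  · intro i z
    simp only [pk_symm]
  · intro i j z hz
    simp_rw [Complex.conj_ofReal, ← Complex.ofReal_mul]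
    rw [integral_complex_ofReal, QQ (h2 i) (h2 j) hz, ← ofReal_norm, Complex.norm_real, Real.norm_of_nonneg (by positivity)]
    unfold pk
    rw [← mul_add, ← ENNReal.ofReal_add (by positivity) (by positivity), ← ENNReal.ofReal_mul (by positivity)]
    exact ENNReal.ofReal_le_ofReal (mul_le_mul_of_nonneg_left (QQ_le (h2 i) (h2 j)) Real.pi_pos.le)
  · intro h hh i x
    simp_rw [mul_assoc]
    rw [lintegral_const_mul _ (show Measurable fun y => pk (2 ^ (e i)) (x - y) * h y from
      ((pk_meas _).comp (by fun_prop)).mul hh)]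
    gcongr
    exact le_iSup (fun j : ℤ => ∫⁻ y, pk ((2 : ℝ) ^ j) (x - y) * h y) (e i)

end OC

namespace OC

lemma Qk_bdd {r : ℝ} (hr : 0 < r) (y : ℝ) : |Qk r y| ≤ r⁻¹ := by
  unfold Qk
  have h : 0 < y ^ 2 + r ^ 2 := by positivity
  rw [abs_div, abs_of_pos h, div_le_iff₀ h, inv_mul_eq_div, le_div_iff₀ hr, ← sq_abs y]
  nlinarith [sq_nonneg (|y| - r), abs_nonneg y, sq_nonneg |y|]

lemma trunc_ge {ρ a w : ℝ} (hρ : 0 < ρ) (h1 : ρ ≤ a) (h : a ≤ |w|) : |1 / w - Qk ρ w| ≤ 2 * (ρ / (ρ ^ 2 + w ^ 2)) := by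
  have hw : 0 < |w| := by linarith
  have hw0 : w ≠ 0 := abs_pos.1 hw
  have : 1 / w - Qk ρ w = ρ ^ 2 / (w * (ρ ^ 2 + w ^ 2)) := by
    unfold Qk
    field_simp; ring
  have hp : 0 < ρ ^ 2 + w ^ 2 := by positivity
  rw [this, abs_div, abs_mul, abs_of_pos hp, abs_of_pos (by positivity : 0 < ρ ^ 2), mul_div_assoc', div_le_div_iff₀ (by positivity) hp]
  have : ρ ^ 2 ≤ 2 * ρ * |w| := by nlinarith
  nlinarith

lemma trunc_lt {ρ a w : ℝ} (hρ : 0 < ρ) (h1 : a < 2 * ρ) (h : |w| ≤ a) : |Qk ρ w| ≤ 2 * (ρ / (ρ ^ 2 + w ^ 2)) := by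
  have hp : 0 < ρ ^ 2 + w ^ 2 := by positivity
  unfold Qk
  rw [add_comm (w ^ 2), abs_div, abs_of_pos hp, mul_div_assoc']
  gcongr
  linarith

noncomputable def Tk (a b w : ℝ) : ℝ := {y : ℝ | a ≤ |y| ∧ |y| ≤ b}.indicator (fun y => 1 / y) w

lemma annulus_meas (a b : ℝ) : MeasurableSet {y : ℝ | a ≤ |y| ∧ |y| ≤ b} :=
  (measurableSet_le measurable_const measurable_id.abs).inter (measurableSet_le measurable_id.abs measurable_const)

lemma Tk_meas (a b : ℝ) : Measurable (Tk a b) :=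
  (measurable_const.div measurable_id).indicator (annulus_meas a b)

lemma Tk_bdd {a b : ℝ} (ha : 0 < a) (w : ℝ) : |Tk a b w| ≤ a⁻¹ := by
  unfold Tk
  by_cases h : w ∈ {y : ℝ | a ≤ |y| ∧ |y| ≤ b}
  · rw [indicator_of_mem h, one_div, abs_inv]
    exact inv_anti₀ ha h.1
  · rw [indicator_of_notMem h]; simp [ha.le]

lemma Tk_err {a b ρ σ w : ℝ} (hρ : 0 < ρ) (hσ : 0 < σ) (hab : a ≤ b) (h1 : ρ ≤ a) (h2 : a < 2 * ρ) (h3 : σ ≤ b) (h4 : b < 2 * σ) :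
    |Tk a b w - (Qk ρ w - Qk σ w)| ≤ 2 * (ρ / (ρ ^ 2 + w ^ 2)) + 2 * (σ / (σ ^ 2 + w ^ 2)) := by
  have hs : Tk a b w - (Qk ρ w - Qk σ w) =
      ((if a ≤ |w| then 1 / w else 0) - Qk ρ w) - ((if b < |w| then 1 / w else 0) - Qk σ w) := by
    unfold Tk
    by_cases c1 : a ≤ |w| <;> by_cases c2 : b < |w|
    · rw [indicator_of_notMem (by simp [c2])]; simp [c1, c2]
    · rw [indicator_of_mem (by exact ⟨c1, not_lt.1 c2⟩)]; simp [c1, c2]; ring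
    · linarith
    · rw [indicator_of_notMem (by simp [c1])]; simp [c1, c2]; ring
  rw [hs]
  refine (abs_sub _ _).trans (add_le_add ?_ ?_)
  · split_ifs with c
    · exact trunc_ge hρ h1 c
    · rw [zero_sub, abs_neg]; exact trunc_lt hρ h2 (not_le.1 c).le
  · split_ifs with c
    · exact trunc_ge hσ h3 c.le
    · rw [zero_sub, abs_neg]; exact trunc_lt hσ h4 (not_lt.1 c)

lemma trunc_bound {f : ℝ → ℂ} (hf : Measurable f) (hfi : Integrable f) {a b : ℝ} (ha : 0 < a) (hab : a ≤ b) (x : ℝ) :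
    ‖∫ y in {y : ℝ | a ≤ |y| ∧ |y| ≤ b}, f (x - y) / (y : ℂ)‖ₑ ≤
      2 * (⨆ j : ℤ, ‖∫ y, ((Qk (2 ^ j) (x - y) : ℝ) : ℂ) * f y‖ₑ) + 4 * PM (fun y => ‖f y‖ₑ) x := by
  obtain ⟨j, hj1, hj2⟩ := exists_mem_Ico_zpow (y := (2:ℝ)) ha (by norm_num)
  obtain ⟨k, hk1, hk2⟩ := exists_mem_Ico_zpow (y := (2:ℝ)) (ha.trans_le hab) (by norm_num)
  rw [zpow_add_one₀ (by norm_num)] at hj2 hk2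
  have e0 : ∫ y in {y : ℝ | a ≤ |y| ∧ |y| ≤ b}, f (x - y) / (y : ℂ) = ∫ y, ((Tk a b (x - y) : ℝ) : ℂ) * f y := by
    rw [← integral_indicator (annulus_meas a b), ← integral_sub_left_eq_self _ volume x]
    refine integral_congr_ae (Eventually.of_forall fun y => ?_)
    dsimp only
    unfold Tk
    by_cases h : x - y ∈ {y : ℝ | a ≤ |y| ∧ |y| ≤ b}
    · rw [indicator_of_mem h, indicator_of_mem h]
      push_cast; rw [sub_sub_cancel]; ring
    · rw [indicator_of_notMem h, indicator_of_notMem h]; simp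
  have intm : ∀ (g : ℝ → ℝ) (c : ℝ), Measurable g → (∀ y, |g y| ≤ c) → Integrable (fun y => ((g (x - y) : ℝ) : ℂ) * f y) := by
    intro g c hg hc
    refine hfi.bdd_mul (c := c) (Complex.measurable_ofReal.comp (hg.comp (by fun_prop))).aestronglyMeasurable (Eventually.of_forall fun y => ?_)
    rw [Complex.norm_real]; exact hc _
  set E : ℝ → ℝ := fun w => Tk a b w - (Qk (2 ^ j) w - Qk (2 ^ k) w) with hE
  have hEm : Measurable E := (Tk_meas a b).sub ((Qk_meas _).sub (Qk_meas _))
  have i1 := intm _ _ (Qk_meas (2 ^ j)) (Qk_bdd (by positivity))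
  have i2 := intm _ _ (Qk_meas (2 ^ k)) (Qk_bdd (by positivity))
  have i3 := intm E (a⁻¹ + ((2 ^ j)⁻¹ + (2 ^ k)⁻¹)) hEm (fun y => (abs_sub _ _).trans (add_le_add (Tk_bdd ha y)
    ((abs_sub _ _).trans (add_le_add (Qk_bdd (by positivity) y) (Qk_bdd (by positivity) y)))))
  have e1 : ∫ y, ((Tk a b (x - y) : ℝ) : ℂ) * f y = ((∫ y, ((Qk (2 ^ j) (x - y) : ℝ) : ℂ) * f y) - ∫ y, ((Qk (2 ^ k) (x - y) : ℝ) : ℂ) * f y)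
      + ∫ y, ((E (x - y) : ℝ) : ℂ) * f y := by
    have i4 := integral_add (i1.sub i2) i3
    simp only [Pi.sub_apply] at i4
    rw [← integral_sub i1 i2, ← i4]
    refine integral_congr_ae (Eventually.of_forall fun y => ?_)
    simp only [hE]
    push_cast; ring
  have e2 : ‖∫ y, ((E (x - y) : ℝ) : ℂ) * f y‖ₑ ≤ 4 * PM (fun y => ‖f y‖ₑ) x := by
    refine (enorm_integral_le_lintegral_enorm _).trans ?_
    have hh : ∀ y, ‖((E (x - y) : ℝ) : ℂ) * f y‖ₑ ≤ 2 * (pk (2 ^ j) (x - y) * ‖f y‖ₑ) + 2 * (pk (2 ^ k) (x - y) * ‖f y‖ₑ) := by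
      intro y
      rw [enorm_mul, ← mul_assoc, ← mul_assoc, ← add_mul]
      gcongr
      unfold pk
      rw [show (2:ℝ≥0∞) = ENNReal.ofReal 2 by simp, ← ENNReal.ofReal_mul (by norm_num), ← ENNReal.ofReal_mul (by norm_num),
        ← ENNReal.ofReal_add (by positivity) (by positivity), ← ofReal_norm, Complex.norm_real]
      exact ENNReal.ofReal_le_ofReal (Tk_err (by positivity) (by positivity) hab hj1 (by linarith) hk1 (by linarith))
    have pm : ∀ i : ℤ, Measurable fun y => pk (2 ^ i) (x - y) * ‖f y‖ₑ := fun i =>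
      ((pk_meas _).comp (by fun_prop)).mul hf.enorm
    refine (lintegral_mono hh).trans ?_
    rw [lintegral_add_left ((pm j).const_mul _), lintegral_const_mul _ (pm j), lintegral_const_mul _ (pm k)]
    have := fun i : ℤ => le_iSup (fun j : ℤ => ∫⁻ y, pk ((2 : ℝ) ^ j) (x - y) * ‖f y‖ₑ) i
    refine (add_le_add (mul_le_mul_right (this j) 2) (mul_le_mul_right (this k) 2)).trans (le_of_eq ?_)
    unfold PM
    ring
  rw [e0, e1]
  refine (enorm_add_le _ _).trans (add_le_add (enorm_sub_le.trans ?_) e2)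
  rw [two_mul]
  have := fun i : ℤ => le_iSup (fun j : ℤ => ‖∫ y, ((Qk (2 ^ j) (x - y) : ℝ) : ℂ) * f y‖ₑ) i
  exact add_le_add (this j) (this k)

end OC

namespace OC

lemma osc {a b : ℝ} (hab : a ≤ b) {φ φ' U U' : ℝ → ℝ} (hφ : ∀ y ∈ Icc a b, HasDerivAt φ (φ' y) y)
    (hφc : ContinuousOn φ' (Icc a b)) (hU : ∀ y ∈ Icc a b, HasDerivAt U (U' y) y)
    (hUc : ContinuousOn U' (Icc a b)) :
    ‖∫ y in a..b, ((φ' y * U y : ℝ) : ℂ) * Complex.exp (Complex.I * (φ y : ℝ))‖ ≤ |U a| + |U b| + ∫ y in a..b, |U' y| := by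
  have hn : ∀ t : ℝ, ‖Complex.exp (Complex.I * (t : ℂ))‖ = 1 := by
    intro t; rw [mul_comm]; exact Complex.norm_exp_ofReal_mul_I t
  have hφcc : ContinuousOn φ (Icc a b) := fun y hy => (hφ y hy).continuousAt.continuousWithinAt
  have d1 : ∀ y ∈ uIcc a b, HasDerivAt (fun y => ((U y : ℝ) : ℂ)) ((U' y : ℝ) : ℂ) y := by
    intro y hy; rw [uIcc_of_le hab] at hy; exact (hU y hy).ofReal_comp
  have d2 : ∀ y ∈ uIcc a b, HasDerivAt (fun y => -Complex.I * Complex.exp (Complex.I * (φ y : ℝ)))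
      (((φ' y : ℝ) : ℂ) * Complex.exp (Complex.I * (φ y : ℝ))) y := by
    intro y hy; rw [uIcc_of_le hab] at hy
    have := (((hφ y hy).ofReal_comp.const_mul Complex.I).cexp).const_mul (-Complex.I)
    refine this.congr_deriv ?_
    have h2 := Complex.I_mul_I
    linear_combination (- Complex.exp (Complex.I * (φ y : ℝ)) * ((φ' y : ℝ) : ℂ)) * h2
  have i1 : IntervalIntegrable (fun y => ((U' y : ℝ) : ℂ)) volume a b := by
    refine ContinuousOn.intervalIntegrable ?_
    rw [uIcc_of_le hab]
    exact Complex.continuous_ofReal.comp_continuousOn hUc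
  have i2 : IntervalIntegrable (fun y => ((φ' y : ℝ) : ℂ) * Complex.exp (Complex.I * (φ y : ℝ))) volume a b := by
    refine ContinuousOn.intervalIntegrable ?_
    rw [uIcc_of_le hab]
    refine (Complex.continuous_ofReal.comp_continuousOn hφc).mul ?_
    exact Complex.continuous_exp.comp_continuousOn (continuousOn_const.mul (Complex.continuous_ofReal.comp_continuousOn hφcc))
  have := intervalIntegral.integral_mul_deriv_eq_deriv_mul d1 d2 i1 i2
  have e : ∫ y in a..b, ((φ' y * U y : ℝ) : ℂ) * Complex.exp (Complex.I * (φ y : ℝ)) =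
      ∫ y in a..b, ((U y : ℝ) : ℂ) * (((φ' y : ℝ) : ℂ) * Complex.exp (Complex.I * (φ y : ℝ))) := by
    congr 1; ext y; push_cast; ring
  rw [e, this]
  refine (norm_sub_le _ _).trans (add_le_add ((norm_sub_le _ _).trans ?_) ?_)
  · rw [norm_mul, norm_mul, norm_mul, norm_mul, hn, hn, add_comm]
    simp
  · refine (intervalIntegral.norm_integral_le_integral_norm hab).trans (le_of_eq ?_)
    congr 1; ext y
    rw [norm_mul, norm_mul, hn]; simp

lemma var_le {a b : ℝ} (hab : a ≤ b) {u u' : ℝ → ℝ} {M : ℝ} (hu : ∀ y ∈ Icc a b, HasDerivAt u (u' y) y)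
    (huc : ContinuousOn u' (Icc a b)) (hs : (∀ y ∈ Icc a b, 0 ≤ u' y) ∨ (∀ y ∈ Icc a b, u' y ≤ 0))
    (hM : ∀ y ∈ Icc a b, |u y| ≤ M) : ∫ y in a..b, |u' y| ≤ 2 * M := by
  have hI : ∫ y in a..b, u' y = u b - u a := by
    refine intervalIntegral.integral_eq_sub_of_hasDerivAt (fun y hy => hu y (by rwa [uIcc_of_le hab] at hy)) ?_
    exact ContinuousOn.intervalIntegrable (by rwa [uIcc_of_le hab])
  have h1 := hM a ⟨le_rfl, hab⟩
  have h2 := hM b ⟨hab, le_rfl⟩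
  rw [abs_le] at h1 h2
  rcases hs with hs | hs
  · rw [intervalIntegral.integral_congr (g := u') (fun y hy => abs_of_nonneg (hs y (by rwa [uIcc_of_le hab] at hy))), hI]
    linarith
  · rw [intervalIntegral.integral_congr (g := fun y => - u' y) (fun y hy => abs_of_nonpos (hs y (by rwa [uIcc_of_le hab] at hy))),
      intervalIntegral.integral_neg, hI]
    linarith

lemma osc3 {a b : ℝ} (hab : a ≤ b) {φ φ' u1 u1' u2 u2' u3 u3' : ℝ → ℝ} {M1 M2 M3 : ℝ}
    (hφ : ∀ y ∈ Icc a b, HasDerivAt φ (φ' y) y) (hφc : ContinuousOn φ' (Icc a b))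
    (h1 : ∀ y ∈ Icc a b, HasDerivAt u1 (u1' y) y) (h1c : ContinuousOn u1' (Icc a b))
    (h1s : (∀ y ∈ Icc a b, 0 ≤ u1' y) ∨ (∀ y ∈ Icc a b, u1' y ≤ 0)) (h1M : ∀ y ∈ Icc a b, |u1 y| ≤ M1)
    (h2 : ∀ y ∈ Icc a b, HasDerivAt u2 (u2' y) y) (h2c : ContinuousOn u2' (Icc a b))
    (h2s : (∀ y ∈ Icc a b, 0 ≤ u2' y) ∨ (∀ y ∈ Icc a b, u2' y ≤ 0)) (h2M : ∀ y ∈ Icc a b, |u2 y| ≤ M2)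
    (h3 : ∀ y ∈ Icc a b, HasDerivAt u3 (u3' y) y) (h3c : ContinuousOn u3' (Icc a b))
    (h3s : (∀ y ∈ Icc a b, 0 ≤ u3' y) ∨ (∀ y ∈ Icc a b, u3' y ≤ 0)) (h3M : ∀ y ∈ Icc a b, |u3 y| ≤ M3) :
    ‖∫ y in a..b, ((φ' y * (u1 y * u2 y * u3 y) : ℝ) : ℂ) * Complex.exp (Complex.I * (φ y : ℝ))‖ ≤ 8 * (M1 * M2 * M3) := by
  have ha : a ∈ Icc a b := ⟨le_rfl, hab⟩
  have hb : b ∈ Icc a b := ⟨hab, le_rfl⟩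
  have p1 : 0 ≤ M1 := (abs_nonneg _).trans (h1M a ha)
  have p2 : 0 ≤ M2 := (abs_nonneg _).trans (h2M a ha)
  have p3 : 0 ≤ M3 := (abs_nonneg _).trans (h3M a ha)
  have c1 : ContinuousOn u1 (Icc a b) := fun y hy => (h1 y hy).continuousAt.continuousWithinAt
  have c2 : ContinuousOn u2 (Icc a b) := fun y hy => (h2 y hy).continuousAt.continuousWithinAt
  have c3 : ContinuousOn u3 (Icc a b) := fun y hy => (h3 y hy).continuousAt.continuousWithinAt
  have hUb : ∀ y ∈ Icc a b, |u1 y * u2 y * u3 y| ≤ M1 * M2 * M3 := by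
    intro y hy
    rw [abs_mul, abs_mul]
    gcongr
    exacts [h1M y hy, h2M y hy, h3M y hy]
  have := osc hab (U := fun y => u1 y * u2 y * u3 y) (U' := fun y => (u1' y * u2 y + u1 y * u2' y) * u3 y + u1 y * u2 y * u3' y)
    hφ hφc (fun y hy => ((h1 y hy).mul (h2 y hy)).mul (h3 y hy)) (by fun_prop)
  refine this.trans ?_
  have q : ∫ y in a..b, |(u1' y * u2 y + u1 y * u2' y) * u3 y + u1 y * u2 y * u3' y| ≤
      ∫ y in a..b, (M2 * M3 * |u1' y| + M1 * M3 * |u2' y| + M1 * M2 * |u3' y|) := by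
    have ii : ∀ g : ℝ → ℝ, ContinuousOn g (Icc a b) → IntervalIntegrable g volume a b := fun g hg =>
      ContinuousOn.intervalIntegrable (by rwa [uIcc_of_le hab])
    refine intervalIntegral.integral_mono_on hab (ii _ (by fun_prop)) (ii _ (by fun_prop)) fun y hy => ?_
    have t1 : |u1' y * u2 y * u3 y| ≤ M2 * M3 * |u1' y| := by
      rw [abs_mul, abs_mul]
      calc _ = |u2 y| * |u3 y| * |u1' y| := by ring
        _ ≤ _ := by gcongr; exacts [h2M y hy, h3M y hy]
    have t2 : |u1 y * u2' y * u3 y| ≤ M1 * M3 * |u2' y| := by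
      rw [abs_mul, abs_mul]
      calc _ = |u1 y| * |u3 y| * |u2' y| := by ring
        _ ≤ _ := by gcongr; exacts [h1M y hy, h3M y hy]
    have t3 : |u1 y * u2 y * u3' y| ≤ M1 * M2 * |u3' y| := by
      rw [abs_mul, abs_mul]
      gcongr; exacts [h1M y hy, h2M y hy]
    calc _ = |u1' y * u2 y * u3 y + u1 y * u2' y * u3 y + u1 y * u2 y * u3' y| := by congr 1; ring
      _ ≤ _ := (abs_add_three _ _ _).trans (by linarith)
  have ii : ∀ g : ℝ → ℝ, ContinuousOn g (Icc a b) → IntervalIntegrable g volume a b := fun g hg =>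
      ContinuousOn.intervalIntegrable (by rwa [uIcc_of_le hab])
  rw [intervalIntegral.integral_add (ii _ (by fun_prop)) (ii _ (by fun_prop)),
    intervalIntegral.integral_add (ii _ (by fun_prop)) (ii _ (by fun_prop)), intervalIntegral.integral_const_mul,
    intervalIntegral.integral_const_mul, intervalIntegral.integral_const_mul] at q
  have v1 := mul_le_mul_of_nonneg_left (var_le hab h1 h1c h1s h1M) (mul_nonneg p2 p3)
  have v2 := mul_le_mul_of_nonneg_left (var_le hab h2 h2c h2s h2M) (mul_nonneg p1 p3)
  have v3 := mul_le_mul_of_nonneg_left (var_le hab h3 h3c h3s h3M) (mul_nonneg p1 p2)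
  have w1 := hUb a ha
  have w2 := hUb b hb
  linarith

lemma lev {a b : ℝ} (hab : a ≤ b) {v : ℝ → ℝ} (hv : ContinuousOn v (Icc a b)) (t : ℝ) :
    ∃ c ∈ Icc a b, (c = a ∨ v c ≤ t) ∧ (c = b ∨ t ≤ v c) := by
  rcases le_total t (v a) with h | h
  · exact ⟨a, ⟨le_rfl, hab⟩, Or.inl rfl, Or.inr h⟩
  rcases le_total (v b) t with h' | h'
  · exact ⟨b, ⟨hab, le_rfl⟩, Or.inr h', Or.inl rfl⟩
  obtain ⟨c, hc, hc'⟩ := intermediate_value_Icc hab hv ⟨h, h'⟩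
  exact ⟨c, hc, Or.inr hc'.le, Or.inr hc'.ge⟩

lemma exp_low {θ v : ℝ} (h0 : 0 < θ) (h1 : θ ≤ 1) (hv : θ ≤ |v|) : θ / 2 ≤ |Real.exp v - 1| := by
  rcases le_total 0 v with h | h
  · rw [abs_of_nonneg h] at hv
    rw [abs_of_nonneg (by linarith [Real.add_one_le_exp v])]
    linarith [Real.add_one_le_exp v]
  · rw [abs_of_nonpos h] at hv
    have h2 : Real.exp v ≤ 1 - θ / 2 := by
      have : Real.exp v ≤ Real.exp (-θ) := Real.exp_le_exp.2 (by linarith)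
      refine this.trans ?_
      rw [Real.exp_neg, inv_le_comm₀ (Real.exp_pos _) (by linarith)]
      refine le_trans ?_ (Real.add_one_le_exp θ)
      rw [inv_le_iff_one_le_mul₀ (by linarith)]
      nlinarith
    rw [abs_of_nonpos (by linarith)]
    linarith

end OC

namespace OC

section
variable (ε lr lq z : ℝ)
noncomputable def S1 (y : ℝ) : ℝ := Real.exp (ε * (Real.log y - lr))
noncomputable def VV (y : ℝ) : ℝ := ε * (Real.log y - lr) - ε * (Real.log (y - z) - lq) + Real.log (y - z) - Real.log y
end

lemma S1_deriv (ε lr z : ℝ) {y : ℝ} (hy : 0 < y - z) :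
    HasDerivAt (fun y => S1 ε lr (y - z)) (ε * S1 ε lr (y - z) / (y - z)) y := by
  unfold S1
  have d0 : HasDerivAt (fun y : ℝ => y - z) 1 y := (hasDerivAt_id y).sub_const z
  have := ((((d0.log hy.ne').sub_const lr).const_mul ε).exp)
  refine this.congr_deriv ?_
  field_simp

lemma S1_deriv0 (ε lr : ℝ) {y : ℝ} (hy : 0 < y) :
    HasDerivAt (S1 ε lr) (ε * S1 ε lr y / y) y := by
  have := S1_deriv ε lr 0 (y := y) (by simpa using hy)
  simpa using this

lemma VV_deriv (ε lr lq z : ℝ) {y : ℝ} (h0 : 0 < y) (hy : 0 < y - z) :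
    HasDerivAt (VV ε lr lq z) ((1 - ε) * z * (1 / (y * (y - z)))) y := by
  unfold VV
  have d0 : HasDerivAt (fun y : ℝ => y - z) 1 y := (hasDerivAt_id y).sub_const z
  have d1 := d0.log hy.ne'
  have d2 := Real.hasDerivAt_log h0.ne'
  have := ((((d2.sub_const lr).const_mul ε).sub ((d1.sub_const lq).const_mul ε)).add d1).sub d2
  refine this.congr_deriv ?_
  field_simp
  ring

lemma S1_pos (ε lr y : ℝ) : 0 < S1 ε lr y := Real.exp_pos _

lemma expV {ε lr lq z y : ℝ} (h0 : 0 < y) (hy : 0 < y - z) :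
    Real.exp (VV ε lr lq z y) = S1 ε lr y * (y - z) / (S1 ε lq (y - z) * y) := by
  unfold VV S1
  rw [Real.exp_sub, Real.exp_add, Real.exp_sub, Real.exp_log hy, Real.exp_log h0]
  field_simp

lemma outer {ε lr lq z a c d L θ : ℝ} (hε : ε ≠ 0) (ha : 0 < a) (hac : a ≤ c) (hcd : c ≤ d)
    (hz : 0 < c - z) (hL : 0 < L) (h0 : 0 < θ) (h1 : θ ≤ 1) (hs2 : ∀ y ∈ Icc c d, 1 ≤ S1 ε lq (y - z))
    (hv : ∀ y ∈ Icc c d, θ ≤ |VV ε lr lq z y|) :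
    ‖∫ y in c..d, ((1 / (y * (y - z)) : ℝ) : ℂ) * Complex.exp (Complex.I * (L * (S1 ε lr y - S1 ε lq (y - z)) : ℝ))‖
      ≤ 16 / (L * |ε| * a * θ) := by
  have py : ∀ y ∈ Icc c d, 0 < y := fun y hy => by linarith [hy.1]
  have pz : ∀ y ∈ Icc c d, 0 < y - z := fun y hy => by linarith [hy.1]
  have hh : ∀ y ∈ Icc c d, θ / 2 ≤ |Real.exp (VV ε lr lq z y) - 1| := fun y hy => exp_low h0 h1 (hv y hy)
  have hne : ∀ y ∈ Icc c d, Real.exp (VV ε lr lq z y) - 1 ≠ 0 := fun y hy h => by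
    have := hh y hy; rw [h, abs_zero] at this; linarith
  have cid : ContinuousOn (fun y : ℝ => y) (Icc c d) := continuousOn_id
  have cz : ContinuousOn (fun y : ℝ => y - z) (Icc c d) := by fun_prop
  have cS : ContinuousOn (fun y => S1 ε lq (y - z)) (Icc c d) := fun y hy =>
    (S1_deriv ε lq z (pz y hy)).continuousAt.continuousWithinAt
  have cS0 : ContinuousOn (S1 ε lr) (Icc c d) := fun y hy =>
    (S1_deriv0 ε lr (py y hy)).continuousAt.continuousWithinAt
  have cV : ContinuousOn (VV ε lr lq z) (Icc c d) := fun y hy =>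
    (VV_deriv ε lr lq z (py y hy) (pz y hy)).continuousAt.continuousWithinAt
  have key := osc3 hcd (φ := fun y => L * (S1 ε lr y - S1 ε lq (y - z)))
    (φ' := fun y => L * (ε * S1 ε lr y / y - ε * S1 ε lq (y - z) / (y - z)))
    (u1 := fun y => y⁻¹) (u1' := fun y => -(y ^ 2)⁻¹)
    (u2 := fun y => (L * ε)⁻¹ * (S1 ε lq (y - z))⁻¹) (u2' := fun y => (L * ε)⁻¹ * (-(ε * S1 ε lq (y - z) / (y - z)) / S1 ε lq (y - z) ^ 2))
    (u3 := fun y => (Real.exp (VV ε lr lq z y) - 1)⁻¹)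
    (u3' := fun y => -(Real.exp (VV ε lr lq z y) * ((1 - ε) * z * (1 / (y * (y - z))))) / (Real.exp (VV ε lr lq z y) - 1) ^ 2)
    (M1 := a⁻¹) (M2 := (L * |ε|)⁻¹) (M3 := (θ / 2)⁻¹)
    (fun y hy => ((S1_deriv0 ε lr (py y hy)).sub (S1_deriv ε lq z (pz y hy))).const_mul L)
    ?_ (fun y hy => hasDerivAt_inv (py y hy).ne') ?_ ?_ ?_
    (fun y hy => ((S1_deriv ε lq z (pz y hy)).inv (S1_pos _ _ _).ne').const_mul _) ?_ ?_ ?_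
    (fun y hy => (((VV_deriv ε lr lq z (py y hy) (pz y hy)).exp).sub_const 1).inv (hne y hy)) ?_ ?_ ?_
  · refine le_trans (le_of_eq ?_) (key.trans (le_of_eq ?_))
    · congr 1
      refine intervalIntegral.integral_congr fun y hy => ?_
      rw [uIcc_of_le hcd] at hy
      congr 2
      have q1 := py y hy
      have q2 := pz y hy
      have q3 := S1_pos ε lq (y - z)
      have q4 := hne y hy
      have : ε * S1 ε lr y / y - ε * S1 ε lq (y - z) / (y - z) = ε * S1 ε lq (y - z) / (y - z) * (Real.exp (VV ε lr lq z y) - 1) := by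
        rw [expV q1 q2]; field_simp
      rw [this]
      field_simp
    · field_simp; norm_num
  · refine continuousOn_const.mul (((continuousOn_const.mul cS0).div cid fun y hy => (py y hy).ne').sub ((continuousOn_const.mul cS).div cz fun y hy => (pz y hy).ne'))
  · exact ((cid.pow 2).inv₀ fun y hy => (pow_pos (py y hy) 2).ne').neg
  · right; intro y hy; have := py y hy; simp only [Left.neg_nonpos_iff]; positivity
  · intro y hy
    rw [abs_of_pos (inv_pos.2 (py y hy))]
    exact inv_anti₀ ha (hac.trans hy.1)
  · refine continuousOn_const.mul (((continuousOn_const.mul cS).div cz fun y hy => (pz y hy).ne').neg.div (cS.pow 2) fun y hy => (pow_pos (S1_pos _ _ _) 2).ne')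
  · right; intro y hy
    have q2 := pz y hy
    have q3 := S1_pos ε lq (y - z)
    rw [show (L * ε)⁻¹ * (-(ε * S1 ε lq (y - z) / (y - z)) / S1 ε lq (y - z) ^ 2) = -(L⁻¹ * (S1 ε lq (y - z))⁻¹ * (y - z)⁻¹) by field_simp,
      neg_nonpos]
    positivity
  · intro y hy
    rw [abs_mul, abs_inv, abs_mul, abs_of_pos hL, abs_of_pos (inv_pos.2 (S1_pos _ _ _))]
    refine mul_le_of_le_one_right (by positivity) ?_
    exact inv_le_one_of_one_le₀ (hs2 y hy)
  · refine ContinuousOn.div ((ContinuousOn.mul (Real.continuous_exp.comp_continuousOn cV) (continuousOn_const.mul (continuousOn_const.div (cid.mul cz) fun y hy => (mul_pos (py y hy) (pz y hy)).ne'))).neg) (((Real.continuous_exp.comp_continuousOn cV).sub continuousOn_const).pow 2) fun y hy => pow_ne_zero 2 (hne y hy)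
  · have e : ∀ y ∈ Icc c d, 0 ≤ Real.exp (VV ε lr lq z y) * (1 / (y * (y - z))) / (Real.exp (VV ε lr lq z y) - 1) ^ 2 := by
      intro y hy
      have q1 := py y hy
      have q2 := pz y hy
      positivity
    rcases le_total 0 ((1 - ε) * z) with h | h
    · right; intro y hy
      have := mul_nonneg h (e y hy)
      refine le_of_eq_of_le ?_ (neg_nonpos.2 this)
      ring
    · left; intro y hy
      have := mul_nonneg (neg_nonneg.2 h) (e y hy)
      refine le_of_le_of_eq this ?_
      ring
  · intro y hy
    rw [abs_inv]
    exact inv_anti₀ (by positivity) (hh y hy)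

lemma mono_aux {a b κ θ : ℝ} (hab : a ≤ b) {v v' : ℝ → ℝ} (hv : ∀ y ∈ Icc a b, HasDerivAt v (κ * v' y) y)
    (hv' : ∀ y ∈ Icc a b, 0 ≤ v' y) :
    ∃ c d, a ≤ c ∧ c ≤ d ∧ d ≤ b ∧ (c = a ∨ ∀ y ∈ Icc a c, θ ≤ |v y|) ∧ (d = b ∨ ∀ y ∈ Icc d b, θ ≤ |v y|) ∧
      (d = c ∨ |v d - v c| ≤ 2 * θ) := by
  -- reduce to monotone
  have main : ∀ w w' : ℝ → ℝ, (∀ y ∈ Icc a b, HasDerivAt w (w' y) y) → (∀ y ∈ Icc a b, 0 ≤ w' y) →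
    ∃ c d, a ≤ c ∧ c ≤ d ∧ d ≤ b ∧ (c = a ∨ ∀ y ∈ Icc a c, θ ≤ |w y|) ∧ (d = b ∨ ∀ y ∈ Icc d b, θ ≤ |w y|) ∧
      (d = c ∨ |w d - w c| ≤ 2 * θ) := by
    intro w w' hw hw'
    have wc : ContinuousOn w (Icc a b) := fun y hy => (hw y hy).continuousAt.continuousWithinAt
    have wm : MonotoneOn w (Icc a b) := by
      refine monotoneOn_of_deriv_nonneg (convex_Icc a b) wc (fun y hy => ((hw y (interior_subset hy)).differentiableAt.differentiableWithinAt)) fun y hy => ?_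
      rw [(hw y (interior_subset hy)).deriv]; exact hw' y (interior_subset hy)
    obtain ⟨c, hc, c1, c2⟩ := lev hab wc (-θ)
    obtain ⟨d, hd, d1, d2⟩ := lev hc.2 (wc.mono (Icc_subset_Icc_left hc.1)) θ
    have hdI : d ∈ Icc a b := ⟨hc.1.trans hd.1, hd.2⟩
    refine ⟨c, d, hc.1, hd.1, hd.2, ?_, ?_, ?_⟩
    · refine c1.imp_right fun h y hy => ?_
      have := wm ⟨hy.1, hy.2.trans hc.2⟩ hc hy.2
      rw [le_abs]; right; linarith
    · refine d2.imp_right fun h y hy => ?_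
      have := wm hdI ⟨hdI.1.trans hy.1, hy.2⟩ hy.1
      rw [le_abs]; left; linarith
    · rcases eq_or_ne d c with h | h
      · exact Or.inl h
      right
      have e1 : w d ≤ θ := d1.resolve_left h
      have e2 : -θ ≤ w c := c2.resolve_left (fun h' => h (le_antisymm (h' ▸ hd.2) hd.1))
      have := wm hc hdI hd.1
      rw [abs_of_nonneg (by linarith)]
      linarith
  rcases le_total 0 κ with h | h
  · exact main v _ hv (fun y hy => mul_nonneg h (hv' y hy))
  · obtain ⟨c, d, h1, h2, h3, h4, h5, h6⟩ := main (fun y => - v y) (fun y => - (κ * v' y)) (fun y hy => (hv y hy).neg)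
      (fun y hy => neg_nonneg.2 (mul_nonpos_of_nonpos_of_nonneg h (hv' y hy)))
    refine ⟨c, d, h1, h2, h3, ?_, ?_, ?_⟩
    · simpa using h4
    · simpa using h5
    · rw [show -v d - -v c = -(v d - v c) by ring, abs_neg] at h6
      exact h6

lemma core {ε lr lq z a b L θ : ℝ} (hε : ε ≠ 0) (hε1 : ε ≠ 1) (hz0 : z ≠ 0) (ha : 0 < a) (hab : a ≤ b)
    (hz : 0 < a - z) (hL : 0 < L) (h0 : 0 < θ) (h1 : θ ≤ 1) (hs2 : ∀ y ∈ Icc a b, 1 ≤ S1 ε lq (y - z)) :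
    ‖∫ y in a..b, ((1 / (y * (y - z)) : ℝ) : ℂ) * Complex.exp (Complex.I * (L * (S1 ε lr y - S1 ε lq (y - z)) : ℝ))‖
      ≤ 32 / (L * |ε| * a * θ) + 2 * θ / (|ε - 1| * |z|) := by
  have py : ∀ y ∈ Icc a b, 0 < y := fun y hy => by linarith [hy.1]
  have pz : ∀ y ∈ Icc a b, 0 < y - z := fun y hy => by linarith [hy.1]
  have pp : 0 < |ε - 1| * |z| := mul_pos (abs_pos.2 (sub_ne_zero.2 hε1)) (abs_pos.2 hz0)
  have pe : 0 < |ε| := abs_pos.2 hε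
  obtain ⟨c, d, hac, hcd, hdb, hl, hr, hm⟩ := mono_aux (θ := θ) hab (v := VV ε lr lq z) (fun y hy => VV_deriv ε lr lq z (py y hy) (pz y hy))
    (fun y hy => by have := py y hy; have := pz y hy; positivity)
  set F : ℝ → ℂ := fun y => ((1 / (y * (y - z)) : ℝ) : ℂ) * Complex.exp (Complex.I * (L * (S1 ε lr y - S1 ε lq (y - z)) : ℝ)) with hF
  have cS : ContinuousOn (fun y => S1 ε lq (y - z)) (Icc a b) := fun y hy =>
    (S1_deriv ε lq z (pz y hy)).continuousAt.continuousWithinAt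
  have cS0 : ContinuousOn (S1 ε lr) (Icc a b) := fun y hy =>
    (S1_deriv0 ε lr (py y hy)).continuousAt.continuousWithinAt
  have cg : ContinuousOn (fun y : ℝ => 1 / (y * (y - z))) (Icc a b) :=
    continuousOn_const.div (by fun_prop) fun y hy => (mul_pos (py y hy) (pz y hy)).ne'
  have cF : ContinuousOn F (Icc a b) := by
    refine (Complex.continuous_ofReal.comp_continuousOn cg).mul ?_
    exact Complex.continuous_exp.comp_continuousOn (continuousOn_const.mul (Complex.continuous_ofReal.comp_continuousOn (continuousOn_const.mul (cS0.sub cS))))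
  have iF : ∀ p q, a ≤ p → p ≤ q → q ≤ b → IntervalIntegrable F volume p q := fun p q h1 h2 h3 =>
    ContinuousOn.intervalIntegrable (cF.mono (by rw [uIcc_of_le h2]; exact Icc_subset_Icc h1 h3))
  have e : ∫ y in a..b, F y = (∫ y in a..c, F y) + (∫ y in c..d, F y) + ∫ y in d..b, F y := by
    rw [intervalIntegral.integral_add_adjacent_intervals (iF a c le_rfl hac (hcd.trans hdb)) (iF c d hac hcd hdb),
      intervalIntegral.integral_add_adjacent_intervals (iF a d le_rfl (hac.trans hcd) hdb) (iF d b (hac.trans hcd) hdb le_rfl)]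
  have b1 : ‖∫ y in a..c, F y‖ ≤ 16 / (L * |ε| * a * θ) := by
    rcases hl with rfl | hl
    · rw [intervalIntegral.integral_same, norm_zero]; positivity
    · exact outer hε ha le_rfl hac hz hL h0 h1 (fun y hy => hs2 y ⟨hy.1, hy.2.trans (hcd.trans hdb)⟩) hl
  have b3 : ‖∫ y in d..b, F y‖ ≤ 16 / (L * |ε| * a * θ) := by
    rcases hr with rfl | hr
    · rw [intervalIntegral.integral_same, norm_zero]; positivity
    · exact outer hε ha (hac.trans hcd) hdb (by linarith) hL h0 h1 (fun y hy => hs2 y ⟨(hac.trans hcd).trans hy.1, hy.2⟩) hr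
  have b2 : ‖∫ y in c..d, F y‖ ≤ 2 * θ / (|ε - 1| * |z|) := by
    rcases hm with rfl | hm
    · rw [intervalIntegral.integral_same, norm_zero]; positivity
    · have hI : ∫ y in c..d, (1 - ε) * z * (1 / (y * (y - z))) = VV ε lr lq z d - VV ε lr lq z c := by
        refine intervalIntegral.integral_eq_sub_of_hasDerivAt (fun y hy => ?_) ?_
        · rw [uIcc_of_le hcd] at hy
          have hy' : y ∈ Icc a b := ⟨hac.trans hy.1, hy.2.trans hdb⟩
          exact VV_deriv ε lr lq z (py y hy') (pz y hy')
        · refine ContinuousOn.intervalIntegrable (continuousOn_const.mul (cg.mono ?_))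
          rw [uIcc_of_le hcd]; exact Icc_subset_Icc hac hdb
      have hn : ‖∫ y in c..d, F y‖ ≤ ∫ y in c..d, 1 / (y * (y - z)) := by
        refine (intervalIntegral.norm_integral_le_integral_norm hcd).trans (le_of_eq ?_)
        refine intervalIntegral.integral_congr fun y hy => ?_
        rw [uIcc_of_le hcd] at hy
        have hy' : y ∈ Icc a b := ⟨hac.trans hy.1, hy.2.trans hdb⟩
        simp only [hF]
        rw [norm_mul, mul_comm Complex.I, Complex.norm_exp_ofReal_mul_I, mul_one, Complex.norm_real, Real.norm_of_nonneg]
        have := py y hy'; have := pz y hy'; positivity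
      rw [intervalIntegral.integral_const_mul] at hI
      refine hn.trans ?_
      rw [le_div_iff₀ pp]
      refine le_trans ?_ hm
      rw [← hI, abs_mul, abs_mul, abs_sub_comm 1 ε, mul_comm]
      gcongr
      exact le_abs_self _
  rw [e]
  refine (norm_add₃_le).trans ?_
  have : 32 / (L * |ε| * a * θ) = 16 / (L * |ε| * a * θ) + 16 / (L * |ε| * a * θ) := by ring
  linarith

end OC

namespace OC

noncomputable def p0 (ε : ℝ) : ℝ := min 0 (Real.log 2 / ε)
noncomputable def p1 (ε : ℝ) : ℝ := max 0 (Real.log 2 / ε)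
noncomputable def EI (ε l : ℝ) : Set ℝ := Icc (Real.exp (l + p0 ε)) (Real.exp (l + p1 ε))
noncomputable def KO (ε L l y : ℝ) : ℂ :=
  (EI ε l).indicator (fun y => ((1 / y : ℝ) : ℂ) * Complex.exp (Complex.I * (L * S1 ε l y : ℝ))) y

lemma p_bounds {δ ε : ℝ} (hδ : 0 < δ) (hε : δ < |ε|) : -(Real.log 2 / δ) ≤ p0 ε ∧ p1 ε ≤ Real.log 2 / δ ∧ p0 ε ≤ p1 ε := by
  have hl : 0 < Real.log 2 := Real.log_pos (by norm_num)
  have h : |Real.log 2 / ε| ≤ Real.log 2 / δ := by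
    rw [abs_div, abs_of_pos hl]
    gcongr
  rw [abs_le] at h
  have : 0 ≤ Real.log 2 / δ := by positivity
  refine ⟨le_min (by linarith) h.1, max_le this h.2, (min_le_left _ _).trans (le_max_left _ _)⟩

lemma EI_pos {ε l y : ℝ} (hy : y ∈ EI ε l) : 0 < y := (Real.exp_pos _).trans_le hy.1

lemma EI_S1 {ε l y : ℝ} (hε : ε ≠ 0) (hy : y ∈ EI ε l) : 1 ≤ S1 ε l y := by
  have h0 := EI_pos hy
  unfold S1
  rw [Real.one_le_exp_iff]
  have h1 := (Real.le_log_iff_exp_le h0).2 hy.1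
  have h2 := (Real.log_le_iff_le_exp h0).2 hy.2
  have hl : 0 < Real.log 2 := Real.log_pos (by norm_num)
  rcases lt_or_gt_of_ne hε with h | h
  · have : p1 ε = 0 := max_eq_left (div_nonpos_of_nonneg_of_nonpos hl.le h.le)
    rw [this] at h2
    exact mul_nonneg_of_nonpos_of_nonpos h.le (by linarith)
  · have : p0 ε = 0 := min_eq_left (by positivity)
    rw [this] at h1
    exact mul_nonneg h.le (by linarith)

lemma S1_meas (ε l : ℝ) : Measurable (S1 ε l) := by
  unfold S1; fun_prop

lemma KO_meas (ε L l : ℝ) : Measurable (KO ε L l) := by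
  refine Measurable.indicator ?_ measurableSet_Icc
  have := S1_meas ε l
  fun_prop

lemma KO_norm (ε L l y : ℝ) : ‖KO ε L l y‖ ≤ (EI ε l).indicator (fun _ => (Real.exp (l + p0 ε))⁻¹) y := by
  unfold KO
  by_cases h : y ∈ EI ε l
  · rw [indicator_of_mem h, indicator_of_mem h, norm_mul, mul_comm Complex.I, Complex.norm_exp_ofReal_mul_I, mul_one,
      Complex.norm_real, Real.norm_of_nonneg (by have := EI_pos h; positivity), one_div]
    exact inv_anti₀ (Real.exp_pos _) h.1
  · rw [indicator_of_notMem h, indicator_of_notMem h, norm_zero]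

lemma KO_sq (ε L l : ℝ) : ∫⁻ y, ‖KO ε L l y‖ₑ ^ 2 ≠ ⊤ := by
  have : ∀ y, ‖KO ε L l y‖ₑ ^ 2 ≤ (EI ε l).indicator (fun _ => ENNReal.ofReal (Real.exp (l + p0 ε))⁻¹ ^ 2) y := by
    intro y
    have := KO_norm ε L l y
    rw [← ofReal_norm]
    by_cases h : y ∈ EI ε l
    · rw [indicator_of_mem h] at *
      gcongr
    · rw [indicator_of_notMem h] at *
      rw [ENNReal.ofReal_eq_zero.2 this]; simp
  refine ne_top_of_le_ne_top ?_ (lintegral_mono this)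
  rw [lintegral_indicator_const (show MeasurableSet (EI ε l) from measurableSet_Icc), EI, Real.volume_Icc]
  finiteness

/-- constant -/
noncomputable def cT (δ : ℝ) : ℝ := (32 * Real.exp (Real.log 2 / δ) ^ 2 + 2) * Real.exp (Real.log 2 / δ) / δ

lemma cT_pos {δ : ℝ} (hδ : 0 < δ) : 0 < cT δ := by unfold cT; positivity

lemma opt {δ M L R z : ℝ} (hδ : 0 < δ) (hM : 1 ≤ M) (hL : 1 ≤ L) (hR : 0 < R) (hz0 : z ≠ 0) (hz : |z| ≤ M * R) :
    ∃ θ, 0 < θ ∧ θ ≤ 1 ∧ 32 / (L * δ * (R / M) * θ) + 2 * θ / (δ * |z|) ≤ (32 * M ^ 2 + 2) * M / δ * L ^ (-(1/2) : ℝ) * er (1/2) R z := by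
  have pz : 0 < |z| := abs_pos.2 hz0
  have hM0 : 0 < M := by linarith
  have hL0 : 0 < L := by linarith
  set θ := Real.sqrt (|z| / (R * M * L)) with hθ
  have h0 : 0 < θ := Real.sqrt_pos.2 (by positivity)
  have hsq : θ ^ 2 = |z| / (R * M * L) := Real.sq_sqrt (by positivity)
  refine ⟨θ, h0, ?_, ?_⟩
  · refine Real.sqrt_le_one.2 ?_
    rw [div_le_one (by positivity)]
    nlinarith [mul_pos hM0 hR]
  · have e1 : 32 / (L * δ * (R / M) * θ) + 2 * θ / (δ * |z|) = (32 * M ^ 2 + 2) / δ * (|z|⁻¹ * θ) := by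
      have : 32 / (L * δ * (R / M) * θ) = 32 * θ / (L * δ * (R / M) * θ ^ 2) := by field_simp
      rw [this, hsq]
      field_simp
    rw [e1]
    have e2 : θ ≤ M * L ^ (-(1/2) : ℝ) * (min (|z| / R) (R / |z|)) ^ (1/2 : ℝ) := by
      have hmin : 0 ≤ min (|z| / R) (R / |z|) := le_min (by positivity) (by positivity)
      have q : M * L ^ (-(1/2) : ℝ) * (min (|z| / R) (R / |z|)) ^ (1/2 : ℝ) = Real.sqrt (M ^ 2 * L⁻¹ * min (|z| / R) (R / |z|)) := by
        rw [Real.sqrt_mul (by positivity), Real.sqrt_mul (by positivity), Real.sqrt_sq hM0.le, Real.rpow_neg hL0.le,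
          ← Real.sqrt_eq_rpow, ← Real.sqrt_eq_rpow, Real.sqrt_inv]
      rw [q, hθ]
      apply Real.sqrt_le_sqrt
      have q2 : |z| / (R * M * L) = L⁻¹ * (|z| / (R * M)) := by field_simp
      rw [q2, mul_comm (M ^ 2), mul_assoc]
      gcongr
      rw [mul_min_of_nonneg _ _ (by positivity)]
      refine le_min ?_ ?_
      · rw [mul_div_assoc', div_le_div_iff₀ (by positivity) hR]
        have : 1 ≤ M ^ 2 * M := by nlinarith [mul_pos hM0 hM0, sq_nonneg (M-1)]
        nlinarith [mul_pos pz hR]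
      · rw [mul_div_assoc', div_le_div_iff₀ (by positivity) pz]
        have : |z| * |z| ≤ (M * R) * (M * R) := mul_self_le_mul_self pz.le hz
        have : (M * R) * (M * R) ≤ M ^ 2 * R * (R * M) := by nlinarith [mul_pos (mul_pos hM0 hR) (mul_pos hM0 hR)]
        linarith
    unfold er
    calc _ ≤ (32 * M ^ 2 + 2) / δ * (|z|⁻¹ * (M * L ^ (-(1/2) : ℝ) * (min (|z| / R) (R / |z|)) ^ (1/2 : ℝ))) := by
          gcongr
      _ = _ := by ring

lemma kerA {δ ε L l l' z : ℝ} (hδ : 0 < δ) (hε : δ < |ε|) (hε1 : δ < |ε - 1|) (hL : 1 ≤ L) (hl : l' ≤ l) (hz0 : z ≠ 0) :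
    ‖∫ y, KO ε L l y * (starRingEnd ℂ) (KO ε L l' (y - z))‖ ≤ cT δ * L ^ (-(1/2) : ℝ) * er (1/2) (Real.exp l) z := by
  have hne : ε ≠ 0 := by rintro rfl; simp at hε; linarith
  have hne1 : ε ≠ 1 := by rintro rfl; simp at hε1; linarith
  obtain ⟨q0, q1, q2⟩ := p_bounds hδ hε
  set M := Real.exp (Real.log 2 / δ) with hM
  have hl2 : 0 < Real.log 2 := Real.log_pos (by norm_num)
  have hM1 : 1 ≤ M := Real.one_le_exp (by positivity)
  set A := max (Real.exp (l + p0 ε)) (z + Real.exp (l' + p0 ε)) with hA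
  set B := min (Real.exp (l + p1 ε)) (z + Real.exp (l' + p1 ε)) with hB
  set F : ℝ → ℂ := fun y => ((1 / (y * (y - z)) : ℝ) : ℂ) * Complex.exp (Complex.I * (L * (S1 ε l y - S1 ε l' (y - z)) : ℝ)) with hF
  have mem : ∀ y, y ∈ Icc A B ↔ y ∈ EI ε l ∧ y - z ∈ EI ε l' := by
    intro y
    simp only [mem_Icc, EI, hA, hB, max_le_iff, le_min_iff, le_sub_iff_add_le, sub_le_iff_le_add]
    rw [add_comm z, add_comm z]
    tauto
  have e : ∀ y, KO ε L l y * (starRingEnd ℂ) (KO ε L l' (y - z)) = (Icc A B).indicator F y := by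
    intro y
    by_cases h : y ∈ Icc A B
    · rw [indicator_of_mem h]
      have h' := (mem y).1 h
      unfold KO
      rw [indicator_of_mem h'.1, indicator_of_mem h'.2, map_mul, ← Complex.exp_conj, map_mul, Complex.conj_I, Complex.conj_ofReal, Complex.conj_ofReal]
      simp only [hF]
      rw [mul_mul_mul_comm, ← Complex.exp_add, ← Complex.ofReal_mul, one_div_mul_one_div]
      congr 2; push_cast; ring
    · rw [indicator_of_notMem h]
      rw [mem, not_and_or] at h
      unfold KO
      rcases h with h | h
      · rw [indicator_of_notMem h, zero_mul]
      · rw [indicator_of_notMem h, map_zero, mul_zero]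
  simp_rw [e]
  rw [integral_indicator measurableSet_Icc]
  have rhs0 : 0 ≤ cT δ * L ^ (-(1/2) : ℝ) * er (1/2) (Real.exp l) z :=
    mul_nonneg (mul_nonneg (cT_pos hδ).le (by positivity)) (er_nonneg _ (Real.exp_pos _) _)
  rcases lt_or_ge B A with hBA | hAB
  · rw [Icc_eq_empty (not_le.2 hBA)]; simpa using rhs0
  rw [integral_Icc_eq_integral_Ioc, ← intervalIntegral.integral_of_le hAB]
  have hApos : Real.exp l / M ≤ A := by
    refine le_trans ?_ (le_max_left _ _)
    rw [hM, ← Real.exp_sub]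
    exact Real.exp_le_exp.2 (by linarith)
  have hAp : 0 < A := (Real.exp_pos _).trans_le (le_max_left _ _)
  have hAI := (mem A).1 ⟨le_rfl, hAB⟩
  have hzz : 0 < A - z := EI_pos hAI.2
  have hzb : |z| ≤ M * Real.exp l := by
    have t1 : A ≤ M * Real.exp l := hAI.1.2.trans (by rw [hM, ← Real.exp_add]; exact Real.exp_le_exp.2 (by linarith))
    have t2 : A - z ≤ M * Real.exp l := hAI.2.2.trans (by rw [hM, ← Real.exp_add]; exact Real.exp_le_exp.2 (by linarith))
    rw [abs_le]; constructor <;> linarith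
  obtain ⟨θ, t0, t1, t2⟩ := opt hδ hM1 hL (Real.exp_pos l) hz0 hzb
  have pz : 0 < |z| := abs_pos.2 hz0
  have hL0 : 0 < L := by linarith
  refine (core hne hne1 hz0 hAp hAB hzz hL0 t0 t1 (fun y hy => EI_S1 hne ((mem y).1 hy).2)).trans (le_trans ?_ t2)
  gcongr

lemma kerB {δ ε L z : ℝ} (hδ : 0 < δ) (hε : δ < |ε|) (hε1 : δ < |ε - 1|) (hL : 1 ≤ L) (hz0 : z ≠ 0) (l l' : ℝ) :
    ‖∫ y, KO ε L l y * (starRingEnd ℂ) (KO ε L l' (y - z))‖ₑ ≤ ENNReal.ofReal (cT δ * L ^ (-(1/2) : ℝ)) * ek (1/2) (Real.exp l) z +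
      ENNReal.ofReal (cT δ * L ^ (-(1/2) : ℝ)) * ek (1/2) (Real.exp l') z := by
  have c0 : 0 ≤ cT δ * L ^ (-(1/2) : ℝ) := mul_nonneg (cT_pos hδ).le (by positivity)
  unfold ek
  rw [← ENNReal.ofReal_mul c0, ← ENNReal.ofReal_mul c0]
  rcases le_total l' l with h | h
  · refine le_trans ?_ le_self_add
    rw [← ofReal_norm]
    exact ENNReal.ofReal_le_ofReal (kerA hδ hε hε1 hL h hz0)
  · refine le_trans ?_ le_add_self
    have := kerA hδ hε hε1 hL h (neg_ne_zero.2 hz0)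
    have e : er (1/2) (Real.exp l') (-z) = er (1/2) (Real.exp l') z := by simp [er]
    rw [e] at this
    rw [← ofReal_norm]
    refine ENNReal.ofReal_le_ofReal (le_trans (le_of_eq ?_) this)
    rw [← RCLike.norm_conj, ← integral_conj, ← integral_add_right_eq_self _ z]
    congr 1
    refine integral_congr_ae (Eventually.of_forall fun y => ?_)
    simp only [map_mul, Complex.conj_conj, sub_neg_eq_add, add_sub_cancel_right]
    ring

end OC

namespace OC

lemma S1_scale {ε l t : ℝ} (ht : 0 < t) : S1 ε l (Real.exp l * t) = S1 ε 0 t := by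
  unfold S1
  rw [Real.log_mul (Real.exp_pos _).ne' ht.ne', Real.log_exp]
  congr 1; ring

lemma EI_scale {ε l t : ℝ} : Real.exp l * t ∈ EI ε l ↔ t ∈ EI ε 0 := by
  unfold EI
  rw [mem_Icc, mem_Icc, Real.exp_add, Real.exp_add, mul_le_mul_iff_right₀ (Real.exp_pos _), mul_le_mul_iff_right₀ (Real.exp_pos _), zero_add, zero_add]

lemma KO_scale (ε L l t : ℝ) : (Real.exp l : ℂ) * KO ε L l (Real.exp l * t) = KO ε L 0 t := by
  unfold KO
  by_cases h : t ∈ EI ε 0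
  · rw [indicator_of_mem h, indicator_of_mem (EI_scale.2 h), S1_scale (EI_pos h), ← mul_assoc, ← Complex.ofReal_mul]
    rw [show Real.exp l * (1 / (Real.exp l * t)) = 1 / t from ?_]
    have := (Real.exp_pos l).ne'
    have := (EI_pos h).ne'
    field_simp
  · rw [indicator_of_notMem h, indicator_of_notMem (fun h' => h (EI_scale.1 h')), mul_zero]

lemma KO_subst (ε L l x : ℝ) (f : ℝ → ℂ) :
    ∫ y, KO ε L l (x - y) * f y = ∫ t, KO ε L 0 t * f (x - Real.exp l * t) := by
  rw [← integral_sub_left_eq_self (fun y => KO ε L l (x - y) * f y) volume x]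
  simp only [sub_sub_cancel]
  have h := Measure.integral_comp_mul_left (fun w => KO ε L l w * f (x - w)) (Real.exp l)
  have e : ∫ w, KO ε L l w * f (x - w) = (Real.exp l : ℂ) * ∫ t, KO ε L l (Real.exp l * t) * f (x - Real.exp l * t) := by
    rw [h, abs_of_pos (by positivity), Complex.real_smul, ← mul_assoc, Complex.ofReal_inv, mul_inv_cancel₀, one_mul]
    exact_mod_cast (Real.exp_pos l).ne'
  rw [e, ← integral_const_mul]
  congr 1; ext t
  rw [← mul_assoc, KO_scale]

lemma KO_integrable (ε L l : ℝ) : Integrable (KO ε L l) := by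
  refine Integrable.mono' (g := (EI ε l).indicator (fun _ => (Real.exp (l + p0 ε))⁻¹)) ?_ (KO_meas _ _ _).aestronglyMeasurable
    (Eventually.of_forall (KO_norm ε L l))
  rw [integrable_indicator_iff (show MeasurableSet (EI ε l) from measurableSet_Icc)]
  exact continuousOn_const.integrableOn_Icc

lemma KO_cont (ε L x : ℝ) {f : ℝ → ℂ} (hf : Continuous f) {M : ℝ} (hM : ∀ y, ‖f y‖ ≤ M) :
    Continuous (fun l => ∫ y, KO ε L l (x - y) * f y) := by
  simp_rw [KO_subst]
  refine continuous_of_dominated (bound := fun t => ‖KO ε L 0 t‖ * M) ?_ ?_ ?_ ?_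
  · intro l
    have := KO_meas ε L 0
    have := hf.measurable
    exact (by fun_prop : Measurable _).aestronglyMeasurable
  · intro l
    refine Eventually.of_forall fun t => ?_
    rw [norm_mul]
    gcongr
    exact hM _
  · exact (KO_integrable ε L 0).norm.mul_const M
  · refine Eventually.of_forall fun t => ?_
    fun_prop

theorem oneside {δ : ℝ} (hδ : 0 < δ) : ∃ C > 0, ∀ ε L : ℝ, δ < |ε| → δ < |ε - 1| → 1 ≤ L → ∀ f : ℝ → ℂ,
    Continuous f → (∃ M, ∀ y, ‖f y‖ ≤ M) → ∫⁻ y, ‖f y‖ₑ ^ 2 ≠ ⊤ →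
    ∫⁻ x, (⨆ l : ℝ, ‖∫ y, KO ε L l (x - y) * f y‖ₑ) ^ 2 ≤ ENNReal.ofReal (C * L ^ (-(1/2) : ℝ)) * ∫⁻ y, ‖f y‖ₑ ^ 2 := by
  obtain ⟨C, hC, hek⟩ := ek_dom (β := 1/2) (by norm_num)
  have hc := cT_pos hδ
  have hcM := cM_pos
  refine ⟨2 * cT δ * C * cM, by positivity, ?_⟩
  rintro ε L hε hε1 hL f hf ⟨M, hM⟩ hf2
  obtain ⟨q, hq⟩ := exists_surjective_nat ℚ
  set c := ENNReal.ofReal (cT δ * L ^ (-(1/2) : ℝ)) with hcdef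
  have key := ttstar (K := fun i => KO ε L (q i)) (fun i => KO_meas _ _ _) (fun i => KO_sq _ _ _)
    (J := fun i z => c * ek (1/2) (Real.exp (q i)) z) (fun i => (ek_meas _ _).const_mul _)
    (fun i z => by simp only [ek_symm]) (D := c * ENNReal.ofReal C)
    (fun i j z hz => kerB hδ hε hε1 hL hz _ _)
    (fun h hh i x => by
      simp only [mul_assoc]
      rw [lintegral_const_mul' _ _ (by finiteness)]
      gcongr
      exact hek _ (Real.exp_pos _) h hh x) hf.measurable hf2
  refine le_trans (le_of_eq ?_) (key.trans (le_of_eq ?_))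
  · refine lintegral_congr fun x => ?_
    congr 1
    refine le_antisymm (iSup_le fun l => ?_) (iSup_le fun i => le_iSup (fun l : ℝ => ‖∫ y, KO ε L l (x - y) * f y‖ₑ) _)
    refine Rat.isDenseEmbedding_coe_real.dense.induction_on (p := fun l : ℝ => ‖∫ y, KO ε L l (x - y) * f y‖ₑ ≤ _) l ?_ ?_
    · exact isClosed_le (KO_cont ε L x hf hM).enorm continuous_const
    · intro r
      obtain ⟨i, rfl⟩ := hq r
      exact le_iSup (fun i => ‖∫ y, KO ε L (q i) (x - y) * f y‖ₑ) i
  · congr 1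
    rw [hcdef, ← ENNReal.ofReal_mul (by positivity), show (2:ℝ≥0∞) = ENNReal.ofReal 2 by simp, ← ENNReal.ofReal_mul (by positivity), ← ENNReal.ofReal_mul (by positivity)]
    congr 1; ring

end OC

namespace OC

lemma primlim {E : Type*} [NormedAddCommGroup E] [NormedSpace ℝ E] {F : ℝ → E} (hF : IntervalIntegrable F volume 0 1) :
    Tendsto (fun a => ∫ y in a..1, F y) (𝓝[>] (0:ℝ)) (𝓝 (∫ y in (0:ℝ)..1, F y)) := by
  have h := intervalIntegral.continuousOn_primitive_interval_left (μ := volume) (f := F) (a := 0) (b := 1) ?_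
  · have h0 := h 0 (by simp)
    refine h0.mono_left ?_
    apply nhdsWithin_le_of_mem
    rw [uIcc_of_le zero_le_one]
    exact Icc_mem_nhdsGT (by norm_num)
  · rw [uIcc_of_le zero_le_one]
    rwa [intervalIntegrable_iff_integrableOn_Icc_of_le zero_le_one] at hF

lemma sinlim {ε : ℝ} (hε : ε ≠ 0) (A : ℝ) :
    ∃ v, Tendsto (fun a => ∫ y in a..1, Real.sin (A * y ^ ε) / y) (𝓝[>] (0:ℝ)) (𝓝 v) := by
  rcases lt_or_gt_of_ne hε with h | h
  · by_cases hA : A = 0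
    · subst hA; simp
    have i1 : IntervalIntegrable (fun y : ℝ => Real.cos (A * y ^ ε) * y ^ (-ε - 1) / A) volume 0 1 := by
      have := intervalIntegral.intervalIntegrable_rpow' (a := 0) (b := 1) (r := -ε - 1) (by linarith)
      refine IntervalIntegrable.div_const ?_ _
      refine this.mono_fun (Measurable.aestronglyMeasurable (by fun_prop)) (Eventually.of_forall fun y => ?_)
      dsimp only
      rw [norm_mul]
      exact mul_le_of_le_one_left (norm_nonneg _) (Real.abs_cos_le_one _)
    set W : ℝ → ℝ := fun y => -(Real.cos (A * y ^ ε) * y ^ (-ε) / (A * ε)) with hW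
    have hd : ∀ y : ℝ, 0 < y → HasDerivAt W (Real.sin (A * y ^ ε) / y + Real.cos (A * y ^ ε) * y ^ (-ε - 1) / A) y := by
      intro y hy
      have d1 := (Real.hasDerivAt_rpow_const (x := y) (p := ε) (Or.inl hy.ne')).const_mul A
      have d2 := (Real.hasDerivAt_rpow_const (x := y) (p := -ε) (Or.inl hy.ne'))
      have d3 := ((d1.cos.mul d2).div_const (A * ε)).neg
      refine d3.congr_deriv ?_
      have e1 : y ^ (ε - 1) = y ^ ε / y := Real.rpow_sub_one hy.ne' ε
      have e2 : y ^ (-ε - 1) = y ^ (-ε) / y := Real.rpow_sub_one hy.ne' _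
      have e3 : y ^ (-ε) = (y ^ ε)⁻¹ := Real.rpow_neg hy.le _
      have : y ^ ε ≠ 0 := (Real.rpow_pos_of_pos hy _).ne'
      rw [e1, e2, e3]
      field_simp
      ring
    have hWlim : Tendsto W (𝓝[>] 0) (𝓝 0) := by
      have t1 : Tendsto (fun y : ℝ => y ^ (-ε)) (𝓝[>] 0) (𝓝 0) := by
        have := (Real.continuousAt_rpow_const 0 (-ε) (Or.inr (by linarith))).tendsto
        rw [Real.zero_rpow (by linarith)] at this
        exact this.mono_left nhdsWithin_le_nhds
      have t2 : Tendsto (fun y : ℝ => Real.cos (A * y ^ ε) * y ^ (-ε)) (𝓝[>] 0) (𝓝 0) := by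
        refine squeeze_zero_norm (fun y => ?_) (t1.norm.trans_eq ?_)
        · rw [norm_mul]
          exact mul_le_of_le_one_left (norm_nonneg _) (Real.abs_cos_le_one _)
        · simp
      have := (t2.div_const (A * ε)).neg
      simpa using this
    refine ⟨W 1 - 0 - ∫ y in (0:ℝ)..1, Real.cos (A * y ^ ε) * y ^ (-ε - 1) / A, ?_⟩
    refine (((tendsto_const_nhds (x := W 1)).sub hWlim).sub (primlim i1)).congr' ?_
    filter_upwards [Ioo_mem_nhdsGT (zero_lt_one (α := ℝ))] with a ha
    have pos : ∀ y ∈ uIcc a 1, 0 < y := by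
      intro y hy; rw [uIcc_of_le ha.2.le] at hy; exact ha.1.trans_le hy.1
    have cp : ∀ p : ℝ, ContinuousOn (fun y : ℝ => y ^ p) (uIcc a 1) := fun p y hy =>
      (Real.continuousAt_rpow_const y p (Or.inl (pos y hy).ne')).continuousWithinAt
    have c1 : ContinuousOn (fun y : ℝ => Real.sin (A * y ^ ε) / y) (uIcc a 1) :=
      (Real.continuous_sin.comp_continuousOn ((cp ε).const_mul A)).div continuousOn_id (fun y hy => (pos y hy).ne')
    have c2 : ContinuousOn (fun y : ℝ => Real.cos (A * y ^ ε) * y ^ (-ε - 1) / A) (uIcc a 1) :=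
      ((Real.continuous_cos.comp_continuousOn ((cp ε).const_mul A)).mul (cp _)).div_const A
    have := intervalIntegral.integral_eq_sub_of_hasDerivAt (fun y hy => hd y (pos y hy)) (c1.add c2).intervalIntegrable
    rw [← this, intervalIntegral.integral_add c1.intervalIntegrable c2.intervalIntegrable]
    ring
  · refine ⟨_, primlim ?_⟩
    have := (intervalIntegral.intervalIntegrable_rpow' (a := 0) (b := 1) (r := ε - 1) (by linarith)).const_mul |A|
    refine this.mono_fun' (Measurable.aestronglyMeasurable (by fun_prop)) ?_
    rw [uIoc_of_le zero_le_one]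
    filter_upwards [ae_restrict_mem measurableSet_Ioc] with y hy
    have hy0 : 0 < y := hy.1
    rw [Real.rpow_sub_one hy0.ne', norm_div, Real.norm_of_nonneg hy0.le, ← mul_div_assoc]
    gcongr
    rw [Real.norm_eq_abs]
    refine (Real.abs_sin_le_abs).trans ?_
    rw [abs_mul, abs_of_pos (Real.rpow_pos_of_pos hy0 _)]

end OC

namespace OC

noncomputable def gg (ε A : ℝ) (f : ℝ → ℂ) (x y : ℝ) : ℂ :=
  Complex.exp (Complex.I * (A : ℂ) * ((Real.sign y * |y| ^ ε : ℝ) : ℂ)) * f (x - y) / (y : ℂ)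

noncomputable def gp (ε A : ℝ) (f : ℝ → ℂ) (x y : ℝ) : ℂ :=
  Complex.exp (Complex.I * ((A * y ^ ε : ℝ) : ℂ)) * f (x - y) / (y : ℂ)

noncomputable def gm (ε A : ℝ) (f : ℝ → ℂ) (x y : ℝ) : ℂ :=
  -(Complex.exp (Complex.I * ((-(A * y ^ ε) : ℝ) : ℂ)) * f (x + y) / (y : ℂ))

lemma exp_norm (t : ℝ) : ‖Complex.exp (Complex.I * (t : ℂ))‖ = 1 := by
  rw [mul_comm]; exact Complex.norm_exp_ofReal_mul_I t

lemma gg_pos (ε A : ℝ) (f : ℝ → ℂ) (x : ℝ) {y : ℝ} (hy : 0 < y) : gg ε A f x y = gp ε A f x y := by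
  unfold gg gp
  rw [Real.sign_of_pos hy, abs_of_pos hy]
  push_cast; ring_nf

lemma gg_neg (ε A : ℝ) (f : ℝ → ℂ) (x : ℝ) {y : ℝ} (hy : 0 < y) : gg ε A f x (-y) = gm ε A f x y := by
  unfold gg gm
  rw [Real.sign_of_neg (by linarith), abs_neg, abs_of_pos hy, sub_neg_eq_add]
  push_cast
  rw [div_neg]
  congr 4
  ring

lemma gp_cont {ε A : ℝ} {f : ℝ → ℂ} (hf : Continuous f) (x : ℝ) : ContinuousOn (gp ε A f x) (Ioi 0) := by
  intro y hy
  have h0 : (y : ℂ) ≠ 0 := by exact_mod_cast (ne_of_gt hy)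
  have : ContinuousAt (fun y : ℝ => y ^ ε) y := Real.continuousAt_rpow_const y ε (Or.inl (ne_of_gt hy))
  refine ContinuousAt.continuousWithinAt ?_
  unfold gp
  refine ContinuousAt.div ?_ (by fun_prop) h0
  fun_prop

lemma gm_cont {ε A : ℝ} {f : ℝ → ℂ} (hf : Continuous f) (x : ℝ) : ContinuousOn (gm ε A f x) (Ioi 0) := by
  intro y hy
  have h0 : (y : ℂ) ≠ 0 := by exact_mod_cast (ne_of_gt hy)
  have : ContinuousAt (fun y : ℝ => y ^ ε) y := Real.continuousAt_rpow_const y ε (Or.inl (ne_of_gt hy))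
  refine ContinuousAt.continuousWithinAt ?_
  unfold gm
  refine (ContinuousAt.div ?_ (by fun_prop) h0).neg
  fun_prop

lemma uIcc_pos {a b : ℝ} (ha : 0 < a) (hb : 0 < b) : uIcc a b ⊆ Ioi 0 := fun _ hy => (lt_min ha hb).trans_le hy.1

lemma gp_ii {ε A : ℝ} {f : ℝ → ℂ} (hf : Continuous f) (x : ℝ) {a b : ℝ} (ha : 0 < a) (hb : 0 < b) :
    IntervalIntegrable (gp ε A f x) volume a b := ((gp_cont hf x).mono (uIcc_pos ha hb)).intervalIntegrable

lemma gm_ii {ε A : ℝ} {f : ℝ → ℂ} (hf : Continuous f) (x : ℝ) {a b : ℝ} (ha : 0 < a) (hb : 0 < b) :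
    IntervalIntegrable (gm ε A f x) volume a b := ((gm_cont hf x).mono (uIcc_pos ha hb)).intervalIntegrable

lemma ann_eq {a b : ℝ} (ha : 0 < a) : {y : ℝ | a ≤ |y| ∧ |y| ≤ b} = Icc a b ∪ Icc (-b) (-a) := by
  ext y
  simp only [mem_setOf_eq, mem_union, mem_Icc]
  rcases le_total 0 y with h | h
  · rw [abs_of_nonneg h]
    constructor
    · intro h; exact Or.inl h
    · rintro (h | h)
      · exact h
      · linarith
  · rw [abs_of_nonpos h]
    constructor
    · intro h; exact Or.inr ⟨by linarith, by linarith⟩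
    · rintro (h | h)
      · linarith
      · exact ⟨by linarith, by linarith⟩

lemma gg_io {ε A : ℝ} {f : ℝ → ℂ} (hf : Continuous f) (x : ℝ) {a b : ℝ} (ha : 0 < a) (hab : a ≤ b) :
    IntegrableOn (gg ε A f x) (Icc a b) ∧ IntegrableOn (gg ε A f x) (Icc (-b) (-a)) := by
  have hb : 0 < b := ha.trans_le hab
  have h1 := gp_ii (ε := ε) (A := A) hf x ha hb
  have h2 := gm_ii (ε := ε) (A := A) hf x ha hb
  rw [intervalIntegrable_iff_integrableOn_Icc_of_le hab] at h1 h2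
  refine ⟨h1.congr_fun (fun y hy => (gg_pos ε A f x (ha.trans_le hy.1)).symm) measurableSet_Icc, ?_⟩
  have h3 : IntegrableOn (fun y => gg ε A f x (-y)) (Icc a b) :=
    h2.congr_fun (fun y hy => (gg_neg ε A f x (ha.trans_le hy.1)).symm) measurableSet_Icc
  have h4 := (Measure.measurePreserving_neg (volume : Measure ℝ)).integrableOn_comp_preimage
    (Homeomorph.neg ℝ).measurableEmbedding (f := gg ε A f x) (s := Icc (-b) (-a))
  refine h4.1 ?_
  have e : (Neg.neg ⁻¹' Icc (-b) (-a) : Set ℝ) = Icc a b := by ext y; simp [and_comm]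
  rw [e]
  exact h3

lemma ann_int {ε A : ℝ} {f : ℝ → ℂ} (hf : Continuous f) (x : ℝ) {a b : ℝ} (ha : 0 < a) (hab : a ≤ b) :
    ∫ y in {y : ℝ | a ≤ |y| ∧ |y| ≤ b}, gg ε A f x y = (∫ y in a..b, gp ε A f x y) + ∫ y in a..b, gm ε A f x y := by
  obtain ⟨h1, h2⟩ := gg_io (ε := ε) (A := A) hf x ha hab
  rw [ann_eq ha, setIntegral_union ?_ measurableSet_Icc h1 h2]
  · congr 1
    · rw [integral_Icc_eq_integral_Ioc, ← intervalIntegral.integral_of_le hab]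
      refine intervalIntegral.integral_congr fun y hy => gg_pos ε A f x (uIcc_pos ha (ha.trans_le hab) hy)
    · rw [integral_Icc_eq_integral_Ioc, ← intervalIntegral.integral_of_le (by linarith), ← intervalIntegral.integral_comp_neg]
      refine intervalIntegral.integral_congr fun y hy => gg_neg ε A f x (uIcc_pos ha (ha.trans_le hab) hy)
  · rw [Set.disjoint_left]
    intro y hy hy'
    linarith [hy.1, hy'.2]

lemma nearzero {ε : ℝ} (hε : ε ≠ 0) (A : ℝ) {f : ℝ → ℂ} (hf : Continuous f) {K : ℝ} (hK : ∀ u v, ‖f u - f v‖ ≤ K * |u - v|) (x : ℝ) :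
    ∃ v, Tendsto (fun a => ∫ y in a..1, (gp ε A f x y + gm ε A f x y)) (𝓝[>] (0:ℝ)) (𝓝 v) := by
  obtain ⟨s, hs⟩ := sinlim hε A
  set R : ℝ → ℂ := fun y => Complex.exp (Complex.I * ((A * y ^ ε : ℝ) : ℂ)) * ((f (x - y) - f x) / y)
    - Complex.exp (Complex.I * ((-(A * y ^ ε) : ℝ) : ℂ)) * ((f (x + y) - f x) / y) with hR
  have hfm := hf.measurable
  have bd : ∀ y : ℝ, 0 < y → ‖R y‖ ≤ 2 * K := by
    intro y hy
    simp only [hR]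
    refine (norm_sub_le _ _).trans ?_
    rw [norm_mul, norm_mul, exp_norm, exp_norm, one_mul, one_mul, norm_div, norm_div, Complex.norm_real, Real.norm_of_nonneg hy.le]
    have k1 := hK (x - y) x
    have k2 := hK (x + y) x
    rw [show x - y - x = -y by ring, abs_neg, abs_of_pos hy] at k1
    rw [show x + y - x = y by ring, abs_of_pos hy] at k2
    have := (div_le_iff₀ hy).2 k1
    have := (div_le_iff₀ hy).2 k2
    linarith
  have hRi : IntervalIntegrable R volume 0 1 := by
    refine (intervalIntegrable_const (c := 2 * K)).mono_fun' (Measurable.aestronglyMeasurable (by fun_prop)) ?_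
    rw [uIoc_of_le zero_le_one]
    filter_upwards [ae_restrict_mem measurableSet_Ioc] with y hy using bd y hy.1
  have key : ∀ y : ℝ, 0 < y → gp ε A f x y + gm ε A f x y = R y + (f x * (2 * Complex.I)) * ((Real.sin (A * y ^ ε) / y : ℝ) : ℂ) := by
    intro y hy
    have h0 : (y : ℂ) ≠ 0 := by exact_mod_cast hy.ne'
    simp only [hR, gp, gm]
    push_cast
    rw [Complex.sin]
    generalize hq : (A : ℂ) * ((y ^ ε : ℝ) : ℂ) = q
    rw [mul_comm (-q) Complex.I, mul_comm q Complex.I]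
    generalize Complex.exp (Complex.I * q) = e1
    generalize Complex.exp (Complex.I * -q) = e2
    field_simp
    linear_combination (-(f x) * (e2 - e1)) * Complex.I_sq
  refine ⟨_, ((primlim hRi).add ((Complex.continuous_ofReal.tendsto s).comp hs |>.const_mul (f x * (2 * Complex.I)))).congr' ?_⟩
  filter_upwards [Ioo_mem_nhdsGT (zero_lt_one (α := ℝ))] with a ha
  have pos := uIcc_pos ha.1 (zero_lt_one (α := ℝ))
  have cp : ContinuousOn (fun y : ℝ => y ^ ε) (uIcc a 1) := fun y hy =>
      (Real.continuousAt_rpow_const y ε (Or.inl (ne_of_gt (pos hy)))).continuousWithinAt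
  have c1 : ContinuousOn (fun y : ℝ => Real.sin (A * y ^ ε) / y) (uIcc a 1) :=
      (Real.continuous_sin.comp_continuousOn (cp.const_mul A)).div continuousOn_id (fun y hy => (ne_of_gt (pos hy)))
  have hR2 : IntervalIntegrable R volume a 1 := hRi.mono_set (by
    rw [uIcc_of_le ha.2.le, uIcc_of_le zero_le_one]; exact Icc_subset_Icc_left ha.1.le)
  have c2 : IntervalIntegrable (fun y : ℝ => (f x * (2 * Complex.I)) * ((Real.sin (A * y ^ ε) / y : ℝ) : ℂ)) volume a 1 :=
    ((Complex.continuous_ofReal.comp_continuousOn c1).intervalIntegrable).const_mul _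
  rw [intervalIntegral.integral_congr (fun y hy => key y (pos hy)), intervalIntegral.integral_add hR2 c2]
  congr 1
  rw [intervalIntegral.integral_const_mul]
  congr 1
  exact (intervalIntegral.integral_ofReal).symm

lemma atinf (ε A : ℝ) {f : ℝ → ℂ} (hf : Continuous f) (hfi : Integrable f) (x : ℝ) :
    IntegrableOn (fun y => gp ε A f x y + gm ε A f x y) (Ioi 1) := by
  have hfm := hf.measurable
  have i1 : Integrable (fun y => ‖f (x - y)‖ + ‖f (x + y)‖) := (hfi.comp_sub_left x).norm.add (hfi.comp_add_left x).norm
  refine Integrable.mono' i1.integrableOn (Measurable.aestronglyMeasurable (by unfold gp gm; fun_prop)) ?_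
  filter_upwards [ae_restrict_mem measurableSet_Ioi] with y hy
  have hy1 : (1:ℝ) < y := hy
  refine (norm_add_le _ _).trans ?_
  unfold gp gm
  rw [norm_neg, norm_div, norm_div, norm_mul, norm_mul, exp_norm, exp_norm, one_mul, one_mul, Complex.norm_real, Real.norm_of_nonneg (by linarith)]
  exact add_le_add (div_le_self (norm_nonneg _) hy1.le) (div_le_self (norm_nonneg _) hy1.le)

lemma pv_exists {ε : ℝ} (hε : ε ≠ 0) (A : ℝ) {f : ℝ → ℂ} (hf : Continuous f) (hfi : Integrable f) {K : ℝ}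
    (hK : ∀ u v, ‖f u - f v‖ ≤ K * |u - v|) (x : ℝ) :
    ∃ v, Tendsto (fun p : ℝ × ℝ => ∫ y in {y : ℝ | p.1 ≤ |y| ∧ |y| ≤ p.2}, gg ε A f x y) (𝓝[>] (0:ℝ) ×ˢ atTop) (𝓝 v) := by
  obtain ⟨v, hv⟩ := nearzero hε A hf hK x
  have h2 := intervalIntegral_tendsto_integral_Ioi 1 (atinf ε A hf hfi x) tendsto_id
  refine ⟨_, ((hv.comp tendsto_fst).add (h2.comp tendsto_snd)).congr' ?_⟩
  filter_upwards [prod_mem_prod (Ioo_mem_nhdsGT (zero_lt_one (α := ℝ))) (Ici_mem_atTop (1:ℝ))] with p hp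
  obtain ⟨ha, hb⟩ := hp
  have hb : 1 ≤ p.2 := hb
  have hb0 : 0 < p.2 := by linarith
  have q1 := gp_ii (ε := ε) (A := A) hf x ha.1 zero_lt_one
  have q2 := gm_ii (ε := ε) (A := A) hf x ha.1 zero_lt_one
  have q3 := gp_ii (ε := ε) (A := A) hf x zero_lt_one hb0
  have q4 := gm_ii (ε := ε) (A := A) hf x zero_lt_one hb0
  rw [ann_int hf x ha.1 (ha.2.le.trans hb)]
  rw [← intervalIntegral.integral_add_adjacent_intervals q1 q3, ← intervalIntegral.integral_add_adjacent_intervals q2 q4]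
  simp only [Function.comp, id]
  rw [intervalIntegral.integral_add q1 q2, intervalIntegral.integral_add q3 q4]
  ring

end OC

namespace OC

noncomputable def MK (ε : ℝ) (k : ℕ) (h : ℝ → ℂ) (x : ℝ) : ℝ≥0∞ := ⨆ l : ℝ, ‖∫ y, KO ε (2 ^ k) l (x - y) * h y‖ₑ

lemma KO_contx (ε L l : ℝ) {f : ℝ → ℂ} (hf : Continuous f) {M : ℝ} (hM : ∀ y, ‖f y‖ ≤ M) :
    Continuous (fun x => ∫ y, KO ε L l (x - y) * f y) := by
  simp_rw [KO_subst]
  refine continuous_of_dominated (bound := fun t => ‖KO ε L 0 t‖ * M) ?_ ?_ ?_ ?_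
  · intro x
    have := KO_meas ε L 0
    have := hf.measurable
    exact (by fun_prop : Measurable _).aestronglyMeasurable
  · intro x
    refine Eventually.of_forall fun t => ?_
    rw [norm_mul]
    gcongr
    exact hM _
  · exact (KO_integrable ε L 0).norm.mul_const M
  · refine Eventually.of_forall fun t => ?_
    fun_prop

lemma MK_meas (ε : ℝ) (k : ℕ) {f : ℝ → ℂ} (hf : Continuous f) {M : ℝ} (hM : ∀ y, ‖f y‖ ≤ M) : Measurable (MK ε k f) :=
  (lowerSemicontinuous_iSup fun l => ((KO_contx ε (2 ^ k) l hf hM).enorm).lowerSemicontinuous).measurable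

lemma sumsq {s : ℝ} (s0 : 0 < s) (s1 : s < 1) (a : ℕ → ℝ≥0∞) :
    (∑' k, a k) ^ 2 ≤ ENNReal.ofReal (1 - s)⁻¹ * ∑' k, ENNReal.ofReal (s⁻¹ ^ k) * a k ^ 2 := by
  have hq : 0 < Real.sqrt s := Real.sqrt_pos.2 s0
  have h := cs (μ := Measure.count) (f := fun k : ℕ => ENNReal.ofReal (Real.sqrt s ^ k)) (g := fun k => ENNReal.ofReal ((Real.sqrt s)⁻¹ ^ k) * a k)
    (Measurable.of_discrete).aemeasurable (Measurable.of_discrete).aemeasurable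
  simp only [lintegral_count] at h
  refine le_trans (le_of_eq ?_) (h.trans (le_of_eq ?_))
  · congr 2; ext k
    rw [← mul_assoc, ← ENNReal.ofReal_mul (by positivity), ← mul_pow, mul_inv_cancel₀ hq.ne', one_pow]
    simp
  · congr 1
    · rw [← tsum_geometric_of_lt_one s0.le s1, ENNReal.ofReal_tsum_of_nonneg (fun n => by positivity) (summable_geometric_of_lt_one s0.le s1)]
      congr 1; ext k
      rw [← ENNReal.ofReal_pow (by positivity), ← pow_mul, mul_comm k, pow_mul, Real.sq_sqrt s0.le]
    · congr 1; ext k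
      rw [mul_pow, ← ENNReal.ofReal_pow (by positivity), ← pow_mul, mul_comm k, pow_mul, inv_pow, Real.sq_sqrt s0.le]

theorem sumK {δ : ℝ} (hδ : 0 < δ) : ∃ C > 0, ∀ ε : ℝ, δ < |ε| → δ < |ε - 1| → ∀ f : ℝ → ℂ,
    Continuous f → (∃ M, ∀ y, ‖f y‖ ≤ M) → ∫⁻ y, ‖f y‖ₑ ^ 2 ≠ ⊤ →
    ∫⁻ x, (∑' k, MK ε k f x) ^ 2 ≤ ENNReal.ofReal C * ∫⁻ y, ‖f y‖ₑ ^ 2 := by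
  obtain ⟨C, hC, H⟩ := oneside hδ
  set s : ℝ := 2 ^ (-(1/4) : ℝ) with hs
  have s0 : 0 < s := by positivity
  have s1 : s < 1 := Real.rpow_lt_one_of_one_lt_of_neg (by norm_num) (by norm_num)
  have s2 : 0 < 1 - s := by linarith
  refine ⟨(1 - s)⁻¹ * (C * (1 - s)⁻¹), by positivity, ?_⟩
  rintro ε hε hε1 f hf ⟨M, hM⟩ hf2
  have hL : ∀ k : ℕ, ((2:ℝ) ^ k) ^ (-(1/2) : ℝ) = s ^ k * s ^ k := by
    intro k
    rw [hs, ← mul_pow, ← Real.rpow_add (by norm_num), ← Real.rpow_natCast, ← Real.rpow_natCast, ← Real.rpow_mul (by norm_num), ← Real.rpow_mul (by norm_num)]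
    congr 1; ring
  have hm := fun k => MK_meas ε k hf hM
  calc _ ≤ ∫⁻ x, ENNReal.ofReal (1 - s)⁻¹ * ∑' k, ENNReal.ofReal (s⁻¹ ^ k) * MK ε k f x ^ 2 := lintegral_mono fun x => sumsq s0 s1 _
    _ = ENNReal.ofReal (1 - s)⁻¹ * ∑' k, ENNReal.ofReal (s⁻¹ ^ k) * ∫⁻ x, MK ε k f x ^ 2 := by
      rw [lintegral_const_mul' _ _ (by finiteness), lintegral_tsum (fun k => (((hm k).pow_const 2).const_mul _).aemeasurable)]
      congr 2; ext k
      rw [lintegral_const_mul' _ _ (by finiteness)]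
    _ ≤ ENNReal.ofReal (1 - s)⁻¹ * ∑' k, ENNReal.ofReal (C * s ^ k) * ∫⁻ y, ‖f y‖ₑ ^ 2 := by
      refine mul_le_mul_right ?_ _
      refine ENNReal.tsum_le_tsum fun k => ?_
      have h1 := H ε (2 ^ k) hε hε1 (one_le_pow₀ (by norm_num)) f hf ⟨M, hM⟩ hf2
      refine (mul_le_mul_right h1 _).trans (le_of_eq ?_)
      rw [← mul_assoc, ← ENNReal.ofReal_mul (by positivity), hL]
      congr 2
      rw [inv_pow]
      field_simp
    _ = _ := by
      rw [ENNReal.tsum_mul_right, ← ENNReal.ofReal_tsum_of_nonneg (fun n => by positivity) ((summable_geometric_of_lt_one s0.le s1).mul_left C), tsum_mul_left, tsum_geometric_of_lt_one s0.le s1,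
        ← mul_assoc, ← ENNReal.ofReal_mul (by positivity)]

end OC

namespace OC

noncomputable def cf (f : ℝ → ℂ) (y : ℝ) : ℂ := (starRingEnd ℂ) (f y)
noncomputable def rf (f : ℝ → ℂ) (y : ℝ) : ℂ := f (-y)
noncomputable def vv (ε l : ℝ) (k : ℕ) : ℝ := Real.exp (l + k * (Real.log 2 / ε))

lemma vv_pos (ε l : ℝ) (k : ℕ) : 0 < vv ε l k := Real.exp_pos _

lemma EI_vv (ε l : ℝ) (k : ℕ) : EI ε (l + k * (Real.log 2 / ε)) = uIcc (vv ε l k) (vv ε l (k + 1)) := by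
  unfold EI vv p0 p1
  generalize Real.log 2 / ε = c
  have e : l + ((k + 1 : ℕ) : ℝ) * c = l + k * c + c := by push_cast; ring
  rw [e]
  rcases le_total 0 c with h | h
  · rw [min_eq_left h, max_eq_right h, uIcc_of_le (Real.exp_le_exp.2 (by linarith)), add_zero]
  · rw [min_eq_right h, max_eq_left h, uIcc_of_ge (Real.exp_le_exp.2 (by linarith)), add_zero]

lemma S1_level {ε : ℝ} (hε : ε ≠ 0) (l y : ℝ) (k : ℕ) : 2 ^ k * S1 ε (l + k * (Real.log 2 / ε)) y = S1 ε l y := by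
  unfold S1
  have : (2:ℝ) ^ k = Real.exp (k * Real.log 2) := by
    rw [mul_comm, Real.exp_mul, Real.exp_log (by norm_num), Real.rpow_natCast]
  rw [this, ← Real.exp_add]
  congr 1
  field_simp
  ring

lemma E_ii (ε l : ℝ) {f : ℝ → ℂ} (hf : Continuous f) (x : ℝ) {a b : ℝ} (ha : 0 < a) (hb : 0 < b) :
    IntervalIntegrable (fun y => Complex.exp (Complex.I * (S1 ε l y : ℝ)) * f (x - y) / (y : ℂ)) volume a b := by
  refine ContinuousOn.intervalIntegrable fun y hy => ?_
  have hy0 := uIcc_pos ha hb hy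
  have h0 : (y : ℂ) ≠ 0 := by exact_mod_cast (ne_of_gt hy0)
  have : ContinuousAt (S1 ε l) y := (S1_deriv0 ε l hy0).continuousAt
  refine ContinuousAt.continuousWithinAt ?_
  refine ContinuousAt.div ?_ (by fun_prop) h0
  fun_prop

lemma high {ε : ℝ} (hε : ε ≠ 0) (l : ℝ) {f : ℝ → ℂ} (hf : Continuous f) (x : ℝ) (n : ℕ) :
    ‖∫ y in vv ε l 0..vv ε l n, Complex.exp (Complex.I * (S1 ε l y : ℝ)) * f (x - y) / (y : ℂ)‖ₑ ≤ ∑' k, MK ε k f x := by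
  rw [← intervalIntegral.sum_integral_adjacent_intervals (fun k _ => E_ii ε l hf x (vv_pos ε l k) (vv_pos ε l (k+1)))]
  refine (enorm_sum_le _ _).trans (le_trans (Finset.sum_le_sum fun k _ => ?_) (ENNReal.sum_le_tsum (Finset.range n)))
  refine le_trans (le_of_eq ?_) (le_iSup (fun l : ℝ => ‖∫ y, KO ε (2 ^ k) l (x - y) * f y‖ₑ) (l + k * (Real.log 2 / ε)))
  rw [← ofReal_norm, ← ofReal_norm, intervalIntegral.norm_intervalIntegral_eq, uIoc, ← integral_Icc_eq_integral_Ioc]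
  congr 2
  rw [← integral_sub_left_eq_self (fun y => KO ε (2 ^ k) (l + k * (Real.log 2 / ε)) (x - y) * f y) volume x,
    show Icc (min (vv ε l k) (vv ε l (k+1))) (max (vv ε l k) (vv ε l (k+1))) = EI ε (l + k * (Real.log 2 / ε)) from (EI_vv ε l k).symm,
    ← integral_indicator (show MeasurableSet (EI ε (l + k * (Real.log 2 / ε))) from measurableSet_Icc)]
  congr 1; ext y
  rw [sub_sub_cancel]
  unfold KO
  by_cases h : y ∈ EI ε (l + k * (Real.log 2 / ε))
  · rw [indicator_of_mem h, indicator_of_mem h, S1_level hε]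
    push_cast; ring
  · rw [indicator_of_notMem h, indicator_of_notMem h, zero_mul]

lemma high' {ε : ℝ} (hε : ε ≠ 0) (l : ℝ) {f : ℝ → ℂ} (hf : Continuous f) (x : ℝ) (n : ℕ) :
    ‖∫ y in vv ε l 0..vv ε l n, Complex.exp (Complex.I * (-S1 ε l y : ℝ)) * f (x - y) / (y : ℂ)‖ₑ ≤ ∑' k, MK ε k (cf f) x := by
  have hc : Continuous (cf f) := Complex.continuous_conj.comp hf
  refine le_trans (le_of_eq ?_) (high hε l hc x n)
  rw [← ofReal_norm, ← ofReal_norm, intervalIntegral.norm_intervalIntegral_eq, intervalIntegral.norm_intervalIntegral_eq]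
  congr 1
  rw [← RCLike.norm_conj, ← integral_conj]
  congr 2; ext y
  unfold cf
  rw [map_div₀, map_mul, ← Complex.exp_conj, map_mul, Complex.conj_I, Complex.conj_ofReal, Complex.conj_ofReal]
  push_cast
  congr 3; ring

/-- scale of A -/
noncomputable def lA (ε A : ℝ) : ℝ := -(Real.log |A| / ε)

lemma S1_A {ε A y : ℝ} (hε : ε ≠ 0) (hA : A ≠ 0) (hy : 0 < y) : S1 ε (lA ε A) y = |A| * y ^ ε := by
  unfold S1 lA
  rw [Real.rpow_def_of_pos hy]
  conv_rhs => rw [← Real.exp_log (abs_pos.2 hA)]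
  rw [← Real.exp_add]
  congr 1
  field_simp
  ring

lemma highA {ε A : ℝ} (hε : ε ≠ 0) (hA : A ≠ 0) {f : ℝ → ℂ} (hf : Continuous f) (x : ℝ) (n : ℕ) :
    ‖(∫ y in vv ε (lA ε A) 0..vv ε (lA ε A) n, gp ε A f x y) + ∫ y in vv ε (lA ε A) 0..vv ε (lA ε A) n, gm ε A f x y‖ₑ ≤
      ((∑' k, MK ε k f x) + ∑' k, MK ε k (cf f) x) + ((∑' k, MK ε k (rf f) (-x)) + ∑' k, MK ε k (cf (rf f)) (-x)) := by
  have hr : Continuous (rf f) := hf.comp continuous_neg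
  have pos := uIcc_pos (vv_pos ε (lA ε A) 0) (vv_pos ε (lA ε A) n)
  have rr : ∀ y, f (x + y) = rf f (-x - y) := fun y => by unfold rf; congr 1; ring
  rcases lt_or_gt_of_ne hA with h | h
  · refine (enorm_add_le _ _).trans (add_le_add ?_ ?_)
    · refine le_trans (le_of_eq ?_) ((high' hε (lA ε A) hf x n).trans le_add_self)
      congr 1
      refine intervalIntegral.integral_congr fun y hy => ?_
      rw [S1_A hε hA (pos hy), abs_of_neg h]
      unfold gp
      congr 5; ring
    · refine le_trans (le_of_eq ?_) ((high hε (lA ε A) hr (-x) n).trans le_self_add)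
      rw [← enorm_neg, ← intervalIntegral.integral_neg]
      congr 1
      refine intervalIntegral.integral_congr fun y hy => ?_
      rw [S1_A hε hA (pos hy), abs_of_neg h]
      unfold gm
      rw [rr, neg_neg]
      congr 5; ring
  · refine (enorm_add_le _ _).trans (add_le_add ?_ ?_)
    · refine le_trans (le_of_eq ?_) ((high hε (lA ε A) hf x n).trans le_self_add)
      congr 1
      refine intervalIntegral.integral_congr fun y hy => ?_
      rw [S1_A hε hA (pos hy), abs_of_pos h]
      unfold gp
      rfl
    · refine le_trans (le_of_eq ?_) ((high' hε (lA ε A) hr (-x) n).trans le_add_self)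
      rw [← enorm_neg, ← intervalIntegral.integral_neg]
      congr 1
      refine intervalIntegral.integral_congr fun y hy => ?_
      rw [S1_A hε hA (pos hy), abs_of_pos h]
      unfold gm
      rw [rr, neg_neg]

lemma low {δ ε A C : ℝ} (hε : ε ≠ 0) (hA : A ≠ 0)
    (hek : ∀ R > 0, ∀ h : ℝ → ℝ≥0∞, Measurable h → ∀ x, ∫⁻ y, ek δ R (x - y) * h y ≤ ENNReal.ofReal C * PM h x)
    {f : ℝ → ℂ} (hf : Continuous f) (hfi : Integrable f) (x : ℝ) {a b : ℝ} (ha : 0 < a) (hab : a ≤ b)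
    (hS : ∀ y, a ≤ y → y ≤ b → S1 ε (lA ε A) y ≤ (min (y / Real.exp (lA ε A)) (Real.exp (lA ε A) / y)) ^ δ) :
    ‖∫ y in {y : ℝ | a ≤ |y| ∧ |y| ≤ b}, gg ε A f x y‖ₑ ≤
      (2 * (⨆ j : ℤ, ‖∫ y, ((Qk (2 ^ j) (x - y) : ℝ) : ℂ) * f y‖ₑ) + 4 * PM (fun y => ‖f y‖ₑ) x) +
        ENNReal.ofReal C * PM (fun y => ‖f y‖ₑ) x := by
  have io : IntegrableOn (gg ε A f x) {y : ℝ | a ≤ |y| ∧ |y| ≤ b} := by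
    rw [ann_eq ha]
    exact (gg_io hf x ha hab).1.union (gg_io hf x ha hab).2
  have io2 : IntegrableOn (fun y => f (x - y) / (y : ℂ)) {y : ℝ | a ≤ |y| ∧ |y| ≤ b} := by
    have := (gg_io (ε := ε) (A := 0) hf x ha hab).1.union (gg_io (ε := ε) (A := 0) hf x ha hab).2
    rw [← ann_eq ha] at this
    refine this.congr_fun (fun y _ => ?_) (annulus_meas a b)
    simp [gg]
  have e : ∫ y in {y : ℝ | a ≤ |y| ∧ |y| ≤ b}, gg ε A f x y = (∫ y in {y : ℝ | a ≤ |y| ∧ |y| ≤ b}, f (x - y) / (y : ℂ)) +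
      ∫ y in {y : ℝ | a ≤ |y| ∧ |y| ≤ b}, (gg ε A f x y - f (x - y) / (y : ℂ)) := by
    rw [integral_sub io io2]; ring
  rw [e]
  refine (enorm_add_le _ _).trans (add_le_add (trunc_bound hf.measurable hfi ha hab x) ?_)
  refine (enorm_integral_le_lintegral_enorm _).trans ?_
  refine le_trans ?_ (hek (Real.exp (lA ε A)) (Real.exp_pos _) (fun y => ‖f y‖ₑ) hf.measurable.enorm x)
  rw [← lintegral_sub_left_eq_self (fun y => ek δ (Real.exp (lA ε A)) (x - y) * ‖f y‖ₑ) x]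
  refine le_trans (setLIntegral_mono' (annulus_meas a b) (fun y hy => ?_)) (setLIntegral_le_lintegral _ _)
  obtain ⟨hy1, hy2⟩ := hy
  have py : 0 < |y| := ha.trans_le hy1
  have h1 := hS _ hy1 hy2
  rw [S1_A hε hA py] at h1
  rw [sub_sub_cancel]
  have e2 : gg ε A f x y - f (x - y) / (y : ℂ) = (Complex.exp (Complex.I * ((A * (Real.sign y * |y| ^ ε) : ℝ) : ℂ)) - 1) / y * f (x - y) := by
    unfold gg
    push_cast
    rw [mul_assoc Complex.I]
    ring
  rw [e2, enorm_mul]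
  gcongr
  unfold ek er
  rw [← ofReal_norm]
  apply ENNReal.ofReal_le_ofReal
  rw [norm_div, Complex.norm_real, Real.norm_eq_abs, div_eq_inv_mul]
  gcongr
  refine le_trans ?_ h1
  refine (Real.norm_exp_I_mul_ofReal_sub_one_le).trans ?_
  rw [Real.norm_eq_abs, abs_mul, abs_mul, abs_of_nonneg (Real.rpow_nonneg py.le ε)]
  have : |Real.sign y| ≤ 1 := by
    rcases Real.sign_apply_eq y with h | h | h <;> rw [h] <;> norm_num
  have := Real.rpow_nonneg py.le ε
  gcongr
  exact mul_le_of_le_one_left this ‹_›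

end OC

namespace OC

lemma S1_low_pos {δ ε l y : ℝ} (h0 : 0 < y) (hε : δ ≤ ε) (hy : y ≤ Real.exp l) :
    S1 ε l y ≤ (min (y / Real.exp l) (Real.exp l / y)) ^ δ := by
  have hr := Real.exp_pos l
  have h1 : y / Real.exp l ≤ 1 := (div_le_one hr).2 hy
  have h2 : 1 ≤ Real.exp l / y := (one_le_div h0).2 hy
  rw [min_eq_left (h1.trans h2)]
  have : S1 ε l y = (y / Real.exp l) ^ ε := by
    rw [Real.rpow_def_of_pos (by positivity), Real.log_div h0.ne' hr.ne', Real.log_exp, mul_comm]; rfl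
  rw [this]
  exact Real.rpow_le_rpow_of_exponent_ge (by positivity) h1 hε

lemma S1_low_neg {δ ε l y : ℝ} (h0 : 0 < y) (hε : δ ≤ -ε) (hy : Real.exp l ≤ y) :
    S1 ε l y ≤ (min (y / Real.exp l) (Real.exp l / y)) ^ δ := by
  have hr := Real.exp_pos l
  have h1 : Real.exp l / y ≤ 1 := (div_le_one h0).2 hy
  have h2 : 1 ≤ y / Real.exp l := (one_le_div hr).2 hy
  rw [min_eq_right (h1.trans h2)]
  have : S1 ε l y = (Real.exp l / y) ^ (-ε) := by
    rw [Real.rpow_def_of_pos (by positivity), Real.log_div hr.ne' h0.ne', Real.log_exp]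
    unfold S1; congr 1; ring
  rw [this]
  exact Real.rpow_le_rpow_of_exponent_ge (by positivity) h1 hε

lemma pv_le {g : ℝ → ℂ} {v : ℂ}
    (hv : Tendsto (fun p : ℝ × ℝ => ∫ y in {y : ℝ | p.1 ≤ |y| ∧ |y| ≤ p.2}, g y) (𝓝[>] (0:ℝ) ×ˢ atTop) (𝓝 v))
    {a b : ℕ → ℝ} (ha : Tendsto a atTop (𝓝[>] 0)) (hb : Tendsto b atTop atTop) {B : ℝ≥0∞}
    (hB : ∀ᶠ n in atTop, ‖∫ y in {y : ℝ | a n ≤ |y| ∧ |y| ≤ b n}, g y‖ₑ ≤ B) : ‖pvIntegral g‖ₑ ≤ B := by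
  have : pvIntegral g = v := hv.limUnder_eq
  rw [this]
  exact le_of_tendsto (hv.comp (ha.prodMk hb)).enorm hB

noncomputable def BB (ε C : ℝ) (f : ℝ → ℂ) (x : ℝ) : ℝ≥0∞ :=
  ((2 * (⨆ j : ℤ, ‖∫ y, ((Qk (2 ^ j) (x - y) : ℝ) : ℂ) * f y‖ₑ) + 4 * PM (fun y => ‖f y‖ₑ) x) +
        ENNReal.ofReal C * PM (fun y => ‖f y‖ₑ) x) +
  (((∑' k, MK ε k f x) + ∑' k, MK ε k (cf f) x) + ((∑' k, MK ε k (rf f) (-x)) + ∑' k, MK ε k (cf (rf f)) (-x)))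

lemma exp_gt {u : ℕ → ℝ} (hu : Tendsto u atTop atBot) : Tendsto (fun n => Real.exp (u n)) atTop (𝓝[>] 0) :=
  tendsto_nhdsWithin_of_tendsto_nhds_of_eventually_within _ (Real.tendsto_exp_atBot.comp hu)
    (Eventually.of_forall fun _ => Real.exp_pos _)

lemma ptw {δ ε C : ℝ} (hδ : 0 < δ) (hε : δ < |ε|)
    (hek : ∀ R > 0, ∀ h : ℝ → ℝ≥0∞, Measurable h → ∀ x, ∫⁻ y, ek δ R (x - y) * h y ≤ ENNReal.ofReal C * PM h x)
    {f : ℝ → ℂ} (hf : Continuous f) (hfi : Integrable f) {K : ℝ} (hK : ∀ u v, ‖f u - f v‖ ≤ K * |u - v|) (x A : ℝ) :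
    ‖pvIntegral (gg ε A f x)‖ₑ ≤ BB ε C f x := by
  have hne : ε ≠ 0 := by rintro rfl; simp at hε; linarith
  obtain ⟨v, hv⟩ := pv_exists hne A hf hfi hK x
  have nat : Tendsto (fun n : ℕ => (n : ℝ)) atTop atTop := tendsto_natCast_atTop_atTop
  have l2 : 0 < Real.log 2 := Real.log_pos (by norm_num)
  by_cases hA : A = 0
  · refine pv_le hv (a := fun n => Real.exp (-(n:ℝ))) (b := fun n => Real.exp n) (exp_gt (tendsto_neg_atTop_atBot.comp nat))
      (Real.tendsto_exp_atTop.comp nat) (Eventually.of_forall fun n => ?_)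
    have hab : Real.exp (-(n:ℝ)) ≤ Real.exp n := Real.exp_le_exp.2 (by have : (0:ℝ) ≤ n := n.cast_nonneg; linarith)
    refine le_trans (le_of_eq ?_) ((trunc_bound hf.measurable hfi (Real.exp_pos _) hab x).trans ?_)
    · congr 2; ext y; simp [gg, hA]
    · unfold BB
      exact le_self_add.trans le_self_add
  set l := lA ε A with hl
  have e0 : vv ε l 0 = Real.exp l := by simp [vv]
  rcases lt_or_gt_of_ne hne with h | h
  · rw [abs_of_neg h] at hε
    have hc : Real.log 2 / ε < 0 := div_neg_of_pos_of_neg l2 h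
    refine pv_le hv (a := vv ε l) (b := fun n => Real.exp (l + n)) (exp_gt ?_)
      (Real.tendsto_exp_atTop.comp (tendsto_atTop_add_const_left _ _ nat)) (Eventually.of_forall fun n => ?_)
    · exact tendsto_atBot_add_const_left _ _ (nat.atTop_mul_const_of_neg hc)
    have n0 : (0:ℝ) ≤ n := n.cast_nonneg
    have h1 : vv ε l n ≤ Real.exp l := Real.exp_le_exp.2 (by nlinarith)
    have h2 : Real.exp l ≤ Real.exp (l + n) := Real.exp_le_exp.2 (by linarith)
    have hlow := low hne hA hek hf hfi x (Real.exp_pos l) h2 (fun y hy _ => S1_low_neg ((Real.exp_pos l).trans_le hy) hε.le hy)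
    have hhigh := highA hne hA hf x n
    rw [← hl, e0] at hhigh
    refine le_trans ?_ (add_le_add hlow hhigh)
    rw [ann_int hf x (Real.exp_pos l) h2, ann_int hf x (vv_pos ε l n) (h1.trans h2)]
    rw [← intervalIntegral.integral_add_adjacent_intervals (gp_ii hf x (vv_pos ε l n) (Real.exp_pos l)) (gp_ii hf x (Real.exp_pos l) (Real.exp_pos (l + n))),
      ← intervalIntegral.integral_add_adjacent_intervals (gm_ii hf x (vv_pos ε l n) (Real.exp_pos l)) (gm_ii hf x (Real.exp_pos l) (Real.exp_pos (l + n)))]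
    rw [intervalIntegral.integral_symm (Real.exp l) (vv ε l n), intervalIntegral.integral_symm (Real.exp l) (vv ε l n)]
    refine le_trans (le_of_eq ?_) enorm_sub_le
    congr 1; ring
  · rw [abs_of_pos h] at hε
    have hc : 0 < Real.log 2 / ε := by positivity
    refine pv_le hv (a := fun n => Real.exp (l + -(n:ℝ))) (b := vv ε l) (exp_gt ?_)
      (Real.tendsto_exp_atTop.comp (tendsto_atTop_add_const_left _ _ (nat.atTop_mul_const hc))) (Eventually.of_forall fun n => ?_)
    · exact tendsto_atBot_add_const_left _ _ (tendsto_neg_atTop_atBot.comp nat)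
    have n0 : (0:ℝ) ≤ n := n.cast_nonneg
    have h1 : Real.exp l ≤ vv ε l n := Real.exp_le_exp.2 (by nlinarith)
    have h2 : Real.exp (l + -(n:ℝ)) ≤ Real.exp l := Real.exp_le_exp.2 (by linarith)
    have hlow := low hne hA hek hf hfi x (Real.exp_pos _) h2 (fun y hy hy' => S1_low_pos ((Real.exp_pos _).trans_le hy) hε.le hy')
    have hhigh := highA hne hA hf x n
    rw [← hl, e0] at hhigh
    refine le_trans ?_ (add_le_add hlow hhigh)
    rw [ann_int hf x (Real.exp_pos _) h2, ann_int hf x (Real.exp_pos _) (h2.trans h1)]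
    rw [← intervalIntegral.integral_add_adjacent_intervals (gp_ii hf x (Real.exp_pos (l + -(n:ℝ))) (Real.exp_pos l)) (gp_ii hf x (Real.exp_pos l) (vv_pos ε l n)),
      ← intervalIntegral.integral_add_adjacent_intervals (gm_ii hf x (Real.exp_pos (l + -(n:ℝ))) (Real.exp_pos l)) (gm_ii hf x (Real.exp_pos l) (vv_pos ε l n))]
    refine le_trans (le_of_eq ?_) (enorm_add_le _ _)
    congr 1; ring

lemma sq2 (a b : ℝ≥0∞) : (a + b) ^ 2 ≤ 2 * (a ^ 2 + b ^ 2) := by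
  have := ENNReal.rpow_add_le_mul_rpow_add_rpow a b (p := 2) (by norm_num)
  norm_num at this
  exact this

lemma L2add {F G : ℝ → ℝ≥0∞} {a b : ℝ} (ha : 0 ≤ a) (hb : 0 ≤ b) {N : ℝ≥0∞} (hGm : Measurable G) (hF : ∫⁻ x, F x ^ 2 ≤ ENNReal.ofReal a * N)
    (hG : ∫⁻ x, G x ^ 2 ≤ ENNReal.ofReal b * N) : ∫⁻ x, (F x + G x) ^ 2 ≤ ENNReal.ofReal (2 * (a + b)) * N := by
  calc _ ≤ ∫⁻ x, 2 * (F x ^ 2 + G x ^ 2) := lintegral_mono fun x => sq2 _ _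
    _ = 2 * ((∫⁻ x, F x ^ 2) + ∫⁻ x, G x ^ 2) := by
      rw [lintegral_const_mul' _ _ (by finiteness)]
      congr 1
      exact lintegral_add_right _ (hGm.pow_const 2)
    _ ≤ 2 * (ENNReal.ofReal a * N + ENNReal.ofReal b * N) := mul_le_mul_right (add_le_add hF hG) _
    _ = _ := by
      rw [← add_mul, ← ENNReal.ofReal_add ha hb, ← mul_assoc, ENNReal.ofReal_mul (by norm_num)]; simp

lemma L2mul {F : ℝ → ℝ≥0∞} {a c : ℝ} (hc : 0 ≤ c) {N : ℝ≥0∞} (hF : ∫⁻ x, F x ^ 2 ≤ ENNReal.ofReal a * N) :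
    ∫⁻ x, (ENNReal.ofReal c * F x) ^ 2 ≤ ENNReal.ofReal (c ^ 2 * a) * N := by
  simp only [mul_pow]
  rw [lintegral_const_mul' _ _ (by finiteness), ENNReal.ofReal_mul (by positivity), mul_assoc, ENNReal.ofReal_pow hc]
  gcongr

lemma cf_nice {f : ℝ → ℂ} (hf : Continuous f) {M : ℝ} (hM : ∀ y, ‖f y‖ ≤ M) :
    Continuous (cf f) ∧ (∀ y, ‖cf f y‖ ≤ M) ∧ ∫⁻ y, ‖cf f y‖ₑ ^ 2 = ∫⁻ y, ‖f y‖ₑ ^ 2 := by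
  refine ⟨Complex.continuous_conj.comp hf, fun y => ?_, lintegral_congr fun y => ?_⟩
  · unfold cf; rw [RCLike.norm_conj]; exact hM y
  · unfold cf; rw [← ofReal_norm, RCLike.norm_conj, ofReal_norm]

lemma rf_nice {f : ℝ → ℂ} (hf : Continuous f) {M : ℝ} (hM : ∀ y, ‖f y‖ ≤ M) :
    Continuous (rf f) ∧ (∀ y, ‖rf f y‖ ≤ M) ∧ ∫⁻ y, ‖rf f y‖ₑ ^ 2 = ∫⁻ y, ‖f y‖ₑ ^ 2 := by
  refine ⟨hf.comp continuous_neg, fun y => hM _, ?_⟩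
  exact lintegral_neg_eq_self (μ := volume) (fun y => ‖f y‖ₑ ^ 2)

theorem main {δ : ℝ} (hδ : 0 < δ) : ∃ C > 0, ∀ ε : ℝ, δ < |ε| → δ < |ε - 1| → ∀ f : ℝ → ℂ,
    Continuous f → Integrable f → (∃ M, ∀ y, ‖f y‖ ≤ M) → (∃ K, ∀ u v, ‖f u - f v‖ ≤ K * |u - v|) → ∫⁻ y, ‖f y‖ₑ ^ 2 ≠ ⊤ →
    ∫⁻ x, carlesonOdd ε f x ^ 2 ≤ ENNReal.ofReal C * ∫⁻ y, ‖f y‖ₑ ^ 2 := by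
  obtain ⟨C1, hC1, hek⟩ := ek_dom hδ
  obtain ⟨C2, hC2, hs⟩ := sumK hδ
  have hcM := cM_pos
  refine ⟨2 * (2 * (2 * (2 ^ 2 * (2 * Real.pi * cM) + 4 ^ 2 * cM ^ 2) + C1 ^ 2 * cM ^ 2) + 2 * (2 * (C2 + C2) + 2 * (C2 + C2))), by positivity, ?_⟩
  rintro ε hε hε1 f hf hfi ⟨M, hM⟩ ⟨K, hK⟩ hf2
  set N := ∫⁻ y, ‖f y‖ₑ ^ 2 with hN
  obtain ⟨c1, c2, c3⟩ := cf_nice hf hM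
  obtain ⟨r1, r2, r3⟩ := rf_nice hf hM
  obtain ⟨s1, s2, s3⟩ := cf_nice r1 r2
  have neg : ∀ G : ℝ → ℝ≥0∞, ∫⁻ x, G (-x) ^ 2 = ∫⁻ x, G x ^ 2 := fun G =>
    lintegral_neg_eq_self (μ := volume) (fun y => G y ^ 2)
  have b1 := hs ε hε hε1 f hf ⟨M, hM⟩ hf2
  have b2 := hs ε hε hε1 (cf f) c1 ⟨M, c2⟩ (by rwa [c3])
  have b3 := hs ε hε hε1 (rf f) r1 ⟨M, r2⟩ (by rwa [r3])
  have b4 := hs ε hε hε1 (cf (rf f)) s1 ⟨M, s2⟩ (by rwa [s3, r3])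
  rw [c3] at b2
  rw [r3, ← neg] at b3
  rw [s3, r3, ← neg] at b4
  have m2 : Measurable fun x => ∑' k, MK ε k (cf f) x := Measurable.ennreal_tsum fun k => MK_meas ε k c1 c2
  have m3 : Measurable fun x => ∑' k, MK ε k (rf f) (-x) := Measurable.ennreal_tsum fun k => (MK_meas ε k r1 r2).comp measurable_neg
  have m4 : Measurable fun x => ∑' k, MK ε k (cf (rf f)) (-x) := Measurable.ennreal_tsum fun k => (MK_meas ε k s1 s2).comp measurable_neg
  have m1 : Measurable fun x => ∑' k, MK ε k f x := Measurable.ennreal_tsum fun k => MK_meas ε k hf hM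
  have hP := PM_bound (h := fun y => ‖f y‖ₑ) hf.measurable.enorm
  have mP : Measurable (PM fun y => ‖f y‖ₑ) := PM_meas hf.measurable.enorm
  have hH := hilb hf.measurable hf2
  have hH' : ∫⁻ x, (⨆ j : ℤ, ‖∫ y, ((Qk (2 ^ j) (x - y) : ℝ) : ℂ) * f y‖ₑ) ^ 2 ≤ ENNReal.ofReal (2 * Real.pi * cM) * N := by
    rw [ENNReal.ofReal_mul (by positivity), ENNReal.ofReal_mul (by norm_num)]
    simpa using hH
  have t1 := L2add (by positivity) (by positivity) (mP.const_mul _) (L2mul (c := 2) (by norm_num) hH') (L2mul (c := 4) (by norm_num) hP)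
  have t2 := L2add (by positivity) (by positivity) (mP.const_mul _) t1 (L2mul (c := C1) hC1.le hP)
  have t3 := L2add hC2.le hC2.le m2 b1 b2
  have t4 := L2add hC2.le hC2.le m4 b3 b4
  have t5 := L2add (by positivity) (by positivity) (m3.add m4) t3 t4
  have t6 := L2add (by positivity) (by positivity) ((m1.add m2).add (m3.add m4)) t2 t5
  refine le_trans (lintegral_mono fun x => ?_) t6
  gcongr
  refine iSup_le fun A => ?_
  refine (ptw hδ hε hek hf hfi hK x A).trans (le_of_eq ?_)
  unfold BB
  simp

end OC

theorem stmt_3 (δ : ℝ) (hδ : δ ∈ Set.Ioo (0 : ℝ) 1) :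
    ∃ C : ℝ, 0 < C ∧ ∀ ε : ℝ, δ < |ε| → δ < |ε - 1| → ∀ f : SchwartzMap ℝ ℂ,
      (∫⁻ x : ℝ, carlesonOdd ε (fun y => f y) x ^ (2 : ℝ)) ^ (1 / 2 : ℝ)
        ≤ ENNReal.ofReal C * eLpNorm (fun y => f y) 2 volume := by
  obtain ⟨C, hC, H⟩ := OC.main hδ.1
  refine ⟨Real.sqrt C, Real.sqrt_pos.2 hC, fun ε hε hε1 f => ?_⟩
  have e : eLpNorm (fun y => f y) 2 volume = (∫⁻ y, ‖f y‖ₑ ^ 2) ^ (1 / 2 : ℝ) := by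
    rw [eLpNorm_eq_lintegral_rpow_enorm_toReal (by norm_num) (by norm_num)]
    simp
  have hfin : ∫⁻ y, ‖f y‖ₑ ^ 2 ≠ ⊤ := by
    have := (f.memLp 2 volume).eLpNorm_lt_top
    intro h
    have e' : eLpNorm f 2 volume = (∫⁻ y, ‖f y‖ₑ ^ 2) ^ (1 / 2 : ℝ) := e
    rw [e', h] at this
    norm_num at this
  have hb : ∃ M, ∀ y, ‖f y‖ ≤ M := by
    obtain ⟨M, hM⟩ := f.decay 0 0
    exact ⟨M, fun y => by simpa using hM.2 y⟩
  have hl : ∃ K, ∀ u v, ‖f u - f v‖ ≤ K * |u - v| := by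
    obtain ⟨K, hK⟩ := f.decay 0 1
    refine ⟨K, fun u v => ?_⟩
    refine Convex.norm_image_sub_le_of_norm_fderiv_le (𝕜 := ℝ) (s := Set.univ) (fun z _ => f.differentiableAt) (fun z _ => ?_) convex_univ (Set.mem_univ _) (Set.mem_univ _)
    have := hK.2 z
    rw [pow_zero, one_mul, norm_iteratedFDeriv_one] at this
    exact this
  have key := H ε hε hε1 (fun y => f y) f.continuous f.integrable hb hl hfin
  rw [e]
  simp only [ENNReal.rpow_two]
  calc _ ≤ (ENNReal.ofReal C * ∫⁻ y, ‖f y‖ₑ ^ 2) ^ (1 / 2 : ℝ) := ENNReal.rpow_le_rpow key (by norm_num)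
    _ = _ := by
      rw [ENNReal.mul_rpow_of_nonneg _ _ (by norm_num), ENNReal.ofReal_rpow_of_nonneg hC.le (by norm_num), Real.sqrt_eq_rpow]
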